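/- Let R be a Cohen-Macaulay ring of prime characteristic p with finite F-representation type by finitely generated R-modules M_1, …, M_t, admitting a canonical module ω_R. Suppose that the local ring R_𝔭 is Gorenstein for every nonmaximal prime ideal 𝔭 of R. Let I be an ideal of R and n an integer. Then Ass_R H_I^n(R) ⊆ ⋃_{i=1}^t Ass_R Ext_R^n(M_i^†/IM_i^†, ω_R), where (−)^† = Hom_R(−, ω_R). -/

import Mathlib

/-!
Statement 5: Let `R` be a Cohen-Macaulay ring of prime characteristic `p` with finite
F-representation type by finitely generated modules `M_1, …, M_t`, admitting a canonical
module `ω_R`, with `R_𝔭` Gorenstein for every nonmaximal prime `𝔭`.  Then for any ideal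
`I` and integer `n`, `Ass_R H_I^n(R) ⊆ ⋃_i Ass_R Ext_R^n(M_i†/IM_i†, ω_R)` where
`(−)† = Hom_R(−, ω_R)`.
-/

open CategoryTheory

open scoped DirectSum

universe u

section Defs

variable (R : Type u) [CommRing R]

/-- `Ext_R^i(M, N)` via Mathlib's `Ext` functor on `ModuleCat R`. -/
noncomputable def extCat (i : ℕ) (M N : ModuleCat.{u} R) : ModuleCat.{u} R :=
  ((Ext R (ModuleCat.{u} R) i).obj (Opposite.op M)).obj N

/-- `ω` is a canonical (dualizing) module for `R`: finitely generated, of finite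
injective dimension, the homothety map `R → End_R(ω)` is bijective and
`Ext_R^i(ω, ω) = 0` for `i > 0`. -/
def IsCanonicalModule (ω : Type u) [AddCommGroup ω] [Module R ω] : Prop :=
  Module.Finite R ω ∧
  (∃ n : ℕ, ∀ (M : ModuleCat.{u} R) (i : ℕ), n < i →
    Subsingleton (extCat R i M (ModuleCat.of R ω))) ∧
  Function.Bijective (algebraMap R (Module.End R ω)) ∧
  (∀ i : ℕ, 0 < i → Subsingleton (extCat R i (ModuleCat.of R ω) (ModuleCat.of R ω)))

/-- A (weakly) regular sequence generating a proper ideal. -/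
def IsRegularSeq (rs : List R) : Prop :=
  (∀ (i : ℕ) (hi : i < rs.length) (a : R),
      rs.get ⟨i, hi⟩ * a ∈ Ideal.span {x | x ∈ rs.take i} →
        a ∈ Ideal.span {x | x ∈ rs.take i}) ∧
  Ideal.span {x | x ∈ rs} ≠ ⊤

/-- `R` is a Cohen-Macaulay *local* ring. -/
def IsCMLocalRing : Prop :=
  IsLocalRing R ∧ IsNoetherianRing R ∧
  ∃ rs : List R, IsRegularSeq R rs ∧ (∀ x ∈ rs, ¬IsUnit x) ∧
    (rs.length : WithBot (WithTop ℕ)) = ringKrullDim R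

/-- `R` is a Cohen-Macaulay ring. -/
def IsCMRing : Prop :=
  IsNoetherianRing R ∧
    ∀ (P : Ideal R) (_ : P.IsPrime), IsCMLocalRing (Localization.AtPrime P)

/-- `R` is a Gorenstein local ring: Noetherian local with finite injective dimension
as a module over itself. -/
def IsGorensteinLocalRing : Prop :=
  IsLocalRing R ∧ IsNoetherianRing R ∧
  ∃ n : ℕ, ∀ (M : ModuleCat.{u} R) (i : ℕ), n < i →
    Subsingleton (extCat R i M (ModuleCat.of R R))

end Defs

namespace ExtBridge
open Abelian Limits CochainComplex HomComplex

variable {R : Type u} [CommRing R] {X Y : ModuleCat.{u} R}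

/-- Cocycles of degree `n` with values in `Y` for a projective resolution. -/
def cocycles (P : ProjectiveResolution X) (Y : ModuleCat.{u} R) (n : ℕ) :
    Submodule R (P.complex.X n ⟶ Y) where
  carrier := {f | P.complex.d (n + 1) n ≫ f = 0}
  add_mem' := fun {a b} ha hb => by
    simp only [Set.mem_ofPred_eq] at *
    rw [Preadditive.comp_add, ha, hb, add_zero]
  zero_mem' := by simp
  smul_mem' := fun c x hx => by
    simp only [Set.mem_ofPred_eq] at *
    rw [Linear.comp_smul, hx, smul_zero]

lemma d_comp_cocycle {P : ProjectiveResolution X} {n : ℕ} (f : cocycles P Y n) :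
    P.complex.d (n + 1) n ≫ f.1 = 0 := f.2

/-- The class of a cocycle in the derived-category `Ext`. -/
noncomputable def newClass (P : ProjectiveResolution X) (Y : ModuleCat.{u} R) (n : ℕ) :
    cocycles P Y n →ₗ[R] Abelian.Ext X Y n where
  toFun f := P.extMk f.1 (n + 1) rfl (d_comp_cocycle f)
  map_add' f g := (P.add_extMk f.1 g.1 (n + 1) rfl (d_comp_cocycle f) (d_comp_cocycle g)).symm
  map_smul' r f := by
    rw [RingHom.id_apply, Ext.smul_eq_comp_mk₀, P.extMk_comp_mk₀]
    congr 1

lemma newClass_surjective (P : ProjectiveResolution X) (Y : ModuleCat.{u} R) (n : ℕ) :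
    Function.Surjective (newClass P Y n) := fun α => by
  obtain ⟨f, hf, h⟩ := P.extMk_surjective α (n + 1) rfl
  exact ⟨⟨f, hf⟩, h⟩

lemma newClass_eq_zero_iff_succ (P : ProjectiveResolution X) (Y : ModuleCat.{u} R) (n : ℕ)
    (f : cocycles P Y (n + 1)) :
    newClass P Y (n + 1) f = 0 ↔ ∃ g : P.complex.X n ⟶ Y, P.complex.d (n + 1) n ≫ g = f.1 :=
  P.extMk_eq_zero_iff f.1 (n + 2) rfl (d_comp_cocycle f) n rfl

lemma newClass_eq_zero_iff_zero (P : ProjectiveResolution X) (Y : ModuleCat.{u} R)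
    (f : cocycles P Y 0) :
    newClass P Y 0 f = 0 ↔ f = 0 := by
  refine ⟨fun h => ?_, fun h => by rw [h, map_zero]⟩
  have h' : P.extMk f.1 1 rfl (d_comp_cocycle f) = 0 := h
  rw [← P.extEquivCohomologyClass.apply_eq_iff_eq, P.extEquivCohomologyClass_extMk,
    P.extEquivCohomologyClass_zero, CohomologyClass.mk_eq_zero_iff] at h'
  rw [Cocycle.toSingleMk_mem_coboundaries_iff _ _ _ _ _ 1 (by simp)] at h'
  obtain ⟨g, hg⟩ := h'
  have hz : IsZero (P.cochainComplex.X 1) := P.cochainComplex.isZero_of_isStrictlyLE 0 1 (by simp)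
  have : g = 0 := hz.eq_of_src _ _
  rw [this, comp_zero] at hg
  ext1
  rw [← cancel_epi (P.cochainComplexXIso (-((0 : ℕ) : ℤ)) 0 rfl).hom, ← hg]
  simp

/-- The complex computing `Ext` from a projective resolution. -/
noncomputable abbrev homComplex (P : ProjectiveResolution X) (Y : ModuleCat.{u} R) :
    CochainComplex (ModuleCat.{u} R) ℕ := P.complex.linearYonedaObj R Y

lemma mem_ker_of_cocycle {P : ProjectiveResolution X} {n : ℕ} (f : cocycles P Y n) :
    ((homComplex P Y).sc n).g.hom f.1 = 0 := by
  have h : (homComplex P Y).d n (n + 1) f.1 = 0 := d_comp_cocycle f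
  have e : (ComplexShape.up ℕ).next n = n + 1 := CochainComplex.next ℕ n
  change (homComplex P Y).d n ((ComplexShape.up ℕ).next n) f.1 = 0
  rw [e]
  exact h

/-- The inclusion of cocycles into the kernel of the differential. -/
noncomputable def toKer (P : ProjectiveResolution X) (Y : ModuleCat.{u} R) (n : ℕ) :
    cocycles P Y n →ₗ[R] LinearMap.ker ((homComplex P Y).sc n).g.hom :=
  LinearMap.codRestrict _ (cocycles P Y n).subtype (fun f => mem_ker_of_cocycle f)

/-- The class of a cocycle in the homology of the `Hom` complex. -/
noncomputable def oldClass (P : ProjectiveResolution X) (Y : ModuleCat.{u} R) (n : ℕ) :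
    cocycles P Y n →ₗ[R] extCat R n X Y :=
  (P.isoExt (R := R) n Y).inv.hom ∘ₗ ((homComplex P Y).homologyπ n).hom ∘ₗ
    ((homComplex P Y).sc n).moduleCatCyclesIso.inv.hom ∘ₗ toKer P Y n

lemma oldClass_surjective (P : ProjectiveResolution X) (Y : ModuleCat.{u} R) (n : ℕ) :
    Function.Surjective (oldClass P Y n) := by
  refine Function.Surjective.comp (g := (P.isoExt (R := R) n Y).inv.hom)
    ((ModuleCat.epi_iff_surjective _).1 inferInstance) ?_
  refine Function.Surjective.comp (g := ((homComplex P Y).homologyπ n).hom)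
    ((ModuleCat.epi_iff_surjective _).1 inferInstance) ?_
  refine Function.Surjective.comp (g := ((homComplex P Y).sc n).moduleCatCyclesIso.inv.hom)
    ((ModuleCat.epi_iff_surjective _).1 inferInstance) ?_
  rintro ⟨f, hf⟩
  refine ⟨⟨f, ?_⟩, rfl⟩
  have e : (ComplexShape.up ℕ).next n = n + 1 := CochainComplex.next ℕ n
  change (homComplex P Y).d n ((ComplexShape.up ℕ).next n) f = 0 at hf
  rw [e] at hf
  exact hf

lemma oldClass_eq_zero_iff (P : ProjectiveResolution X) (Y : ModuleCat.{u} R) (n : ℕ)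
    (f : cocycles P Y n) :
    oldClass P Y n f = 0 ↔ ∃ g, ((homComplex P Y).sc n).f.hom g = f.1 := by
  set S := (homComplex P Y).sc n
  have h1 : oldClass P Y n f = 0 ↔ S.homologyπ (S.moduleCatCyclesIso.inv (toKer P Y n f)) = 0 := by
    change (P.isoExt (R := R) n Y).inv (S.homologyπ (S.moduleCatCyclesIso.inv (toKer P Y n f))) = 0
      ↔ _
    exact map_eq_zero_iff _ ((ModuleCat.mono_iff_injective _).1 inferInstance)
  have h2 : S.homologyπ (S.moduleCatCyclesIso.inv (toKer P Y n f)) =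
      S.moduleCatHomologyIso.inv (S.moduleCatLeftHomologyData.π (toKer P Y n f)) := by
    have := congr($(S.moduleCatCyclesIso_inv_π).hom (toKer P Y n f))
    exact this
  have h3 : S.moduleCatHomologyIso.inv (S.moduleCatLeftHomologyData.π (toKer P Y n f)) = 0 ↔
      S.moduleCatLeftHomologyData.π (toKer P Y n f) = 0 :=
    map_eq_zero_iff _ ((ModuleCat.mono_iff_injective _).1 inferInstance)
  have h4 : S.moduleCatLeftHomologyData.π (toKer P Y n f) = 0 ↔
      toKer P Y n f ∈ LinearMap.range S.moduleCatToCycles :=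
    Submodule.Quotient.mk_eq_zero _
  rw [h1, h2, h3, h4]
  constructor
  · rintro ⟨g, hg⟩
    exact ⟨g, congrArg Subtype.val hg⟩
  · rintro ⟨g, hg⟩
    exact ⟨g, Subtype.ext hg⟩

lemma ker_oldClass (P : ProjectiveResolution X) (Y : ModuleCat.{u} R) (n : ℕ) :
    LinearMap.ker (oldClass P Y n) = LinearMap.ker (newClass P Y n) := by
  ext f
  rw [LinearMap.mem_ker, LinearMap.mem_ker, oldClass_eq_zero_iff]
  cases n with
  | zero =>
    rw [newClass_eq_zero_iff_zero]
    have : ((homComplex P Y).sc 0).f = 0 :=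
      (homComplex P Y).shape _ _ (by simp)
    rw [this]
    constructor
    · rintro ⟨g, hg⟩
      exact Subtype.ext hg.symm
    · rintro rfl
      exact ⟨0, rfl⟩
  | succ n =>
    rw [newClass_eq_zero_iff_succ]
    have e : (ComplexShape.up ℕ).prev (n + 1) = n := CochainComplex.prev_nat_succ n
    change (∃ g, (homComplex P Y).d ((ComplexShape.up ℕ).prev (n + 1)) (n + 1) g = f.1) ↔ _
    rw [e]
    rfl

/-- The comparison between the two kinds of `Ext` for a given projective resolution. -/
noncomputable def extEquivOfResolution (P : ProjectiveResolution X) (Y : ModuleCat.{u} R) (n : ℕ) :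
    extCat R n X Y ≃ₗ[R] Abelian.Ext X Y n :=
  ((oldClass P Y n).quotKerEquivOfSurjective (oldClass_surjective P Y n)).symm ≪≫ₗ
    Submodule.quotEquivOfEq _ _ (ker_oldClass P Y n) ≪≫ₗ
    (newClass P Y n).quotKerEquivOfSurjective (newClass_surjective P Y n)

lemma extEquivOfResolution_oldClass (P : ProjectiveResolution X) (Y : ModuleCat.{u} R) (n : ℕ)
    (f : cocycles P Y n) :
    extEquivOfResolution P Y n (oldClass P Y n f) = newClass P Y n f := by
  have : ((oldClass P Y n).quotKerEquivOfSurjective (oldClass_surjective P Y n)).symm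
      (oldClass P Y n f) = Submodule.Quotient.mk f := by
    rw [LinearEquiv.symm_apply_eq]
    rfl
  simp only [extEquivOfResolution, LinearEquiv.trans_apply, this]
  rfl

end ExtBridge

namespace ExtBridge
open Abelian Limits CochainComplex HomComplex

variable {R : Type u} [CommRing R] {X Y : ModuleCat.{u} R}

/-- Functoriality of `extCat` in the first variable. -/
noncomputable def extCatMap {X' X : ModuleCat.{u} R} (g : X' ⟶ X) (Y : ModuleCat.{u} R) (n : ℕ) :
    extCat R n X Y ⟶ extCat R n X' Y :=
  ((Ext R (ModuleCat.{u} R) n).map g.op).app Y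

/-- The map of `Hom` complexes induced by a map of resolutions. -/
noncomputable def homComplexMap {X' X : ModuleCat.{u} R} {P' : ProjectiveResolution X'}
    {P : ProjectiveResolution X} (φ : P'.complex ⟶ P.complex) (Y : ModuleCat.{u} R) :
    homComplex P Y ⟶ homComplex P' Y :=
  (HomologicalComplex.unopFunctor _ _).map
    ((((linearYoneda R (ModuleCat.{u} R)).obj Y).rightOp.mapHomologicalComplex _).map φ).op

lemma comp_square_paste {C : Type*} [Category* C] {A B D A' B' D' : C} (a : A ⟶ B) (b : B ⟶ D)
    (m : D ⟶ D') (a' : A' ⟶ B') (b' : B' ⟶ D') (n : A ⟶ A') (l : B ⟶ B')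
    (h : b ≫ m = l ≫ b') (k : a ≫ l = n ≫ a') : (a ≫ b) ≫ m = n ≫ a' ≫ b' := by
  rw [Category.assoc, h, reassoc_of% k]

lemma isoExt_inv_naturality {X' X : ModuleCat.{u} R} (g : X' ⟶ X) (P' : ProjectiveResolution X')
    (P : ProjectiveResolution X) (φ : P'.complex ⟶ P.complex)
    (comm : φ.f 0 ≫ P.π.f 0 = P'.π.f 0 ≫ g) (Y : ModuleCat.{u} R) (n : ℕ) :
    (P.isoExt (R := R) n Y).inv ≫ extCatMap g Y n =
      HomologicalComplex.homologyMap (homComplexMap φ Y) n ≫ (P'.isoExt (R := R) n Y).inv := by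
  have h := P'.isoLeftDerivedObj_hom_naturality g P φ comm
    ((linearYoneda R (ModuleCat.{u} R)).obj Y).rightOp n
  have h' := congr($(h).unop)
  have k := HomologicalComplex.homologyOp_hom_naturality (homComplexMap φ Y) n
  have k' := congr($(k).unop)
  exact comp_square_paste _ _ _ _ _ _ _ h' k'

/-- Pulling back cocycles along a map of resolutions. -/
def cocyclesMap {X' X : ModuleCat.{u} R} {P' : ProjectiveResolution X'}
    {P : ProjectiveResolution X} (φ : P'.complex ⟶ P.complex) {n : ℕ} (f : cocycles P Y n) :
    cocycles P' Y n :=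
  ⟨φ.f n ≫ f.1, by
    change P'.complex.d (n + 1) n ≫ φ.f n ≫ f.1 = 0
    rw [← φ.comm_assoc, d_comp_cocycle, comp_zero]⟩

lemma extCatMap_oldClass {X' X : ModuleCat.{u} R} (g : X' ⟶ X) (P' : ProjectiveResolution X')
    (P : ProjectiveResolution X) (φ : P'.complex ⟶ P.complex)
    (comm : φ.f 0 ≫ P.π.f 0 = P'.π.f 0 ≫ g) (n : ℕ) (f : cocycles P Y n) :
    extCatMap g Y n (oldClass P Y n f) = oldClass P' Y n (cocyclesMap φ f) := by
  set S := (homComplex P Y).sc n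
  set S' := (homComplex P' Y).sc n
  have h := congr($(isoExt_inv_naturality g P' P φ comm Y n).hom
    (S.homologyπ (S.moduleCatCyclesIso.inv (toKer P Y n f))))
  refine Eq.trans h ?_
  change (P'.isoExt (R := R) n Y).inv (HomologicalComplex.homologyMap (homComplexMap φ Y) n
    (S.homologyπ (S.moduleCatCyclesIso.inv (toKer P Y n f)))) =
    (P'.isoExt (R := R) n Y).inv (S'.homologyπ (S'.moduleCatCyclesIso.inv
      (toKer P' Y n (cocyclesMap φ f))))
  congr 1
  have h2 := congr($(HomologicalComplex.homologyπ_naturality (homComplexMap φ Y) n).hom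
    (S.moduleCatCyclesIso.inv (toKer P Y n f)))
  refine Eq.trans h2 ?_
  change S'.homologyπ (HomologicalComplex.cyclesMap (homComplexMap φ Y) n
    (S.moduleCatCyclesIso.inv (toKer P Y n f))) = _
  congr 1
  apply (ModuleCat.mono_iff_injective S'.iCycles).1 inferInstance
  have h3 := congr($(HomologicalComplex.cyclesMap_i (homComplexMap φ Y) n).hom
    (S.moduleCatCyclesIso.inv (toKer P Y n f)))
  refine Eq.trans h3 ?_
  have h4 := congr($(S.moduleCatCyclesIso_inv_iCycles).hom (toKer P Y n f))
  have h5 := congr($(S'.moduleCatCyclesIso_inv_iCycles).hom (toKer P' Y n (cocyclesMap φ f)))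
  refine Eq.trans ?_ h5.symm
  exact congrArg (fun t => (homComplexMap φ Y).f n t) h4

/-- The comparison between the two kinds of `Ext`. -/
noncomputable def extEquiv (n : ℕ) (X Y : ModuleCat.{u} R) :
    extCat R n X Y ≃ₗ[R] Abelian.Ext X Y n :=
  extEquivOfResolution (projectiveResolution X) Y n

lemma extEquiv_extCatMap {X' X : ModuleCat.{u} R} (g : X' ⟶ X) (Y : ModuleCat.{u} R) (n : ℕ)
    (x : extCat R n X Y) :
    extEquiv n X' Y (extCatMap g Y n x) =
      (Ext.mk₀ g).comp (extEquiv n X Y x) (zero_add n) := by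
  obtain ⟨f, rfl⟩ := oldClass_surjective (projectiveResolution X) Y n x
  let φ := ProjectiveResolution.lift g (projectiveResolution X') (projectiveResolution X)
  have hφ : φ.f 0 ≫ (projectiveResolution X).π.f 0 = (projectiveResolution X').π.f 0 ≫ g := by
    have := congr($(ProjectiveResolution.lift_commutes g (projectiveResolution X')
      (projectiveResolution X)).f 0)
    exact this
  rw [extCatMap_oldClass g _ _ φ hφ]
  simp only [extEquiv]
  rw [extEquivOfResolution_oldClass, extEquivOfResolution_oldClass]
  exact (ProjectiveResolution.mk₀_comp_extMk f.1 (n + 1) rfl (d_comp_cocycle f)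
    (R' := projectiveResolution X') ⟨φ, hφ⟩).symm

end ExtBridge

namespace LocCoh
open Abelian Limits ExtBridge Opposite

variable {R : Type u} [CommRing R]

/-- The projection `R ⧸ J → R ⧸ I` for ideals `J ≤ I`. -/
abbrev quotMap {J I : Ideal R} (h : J ≤ I) : ModuleCat.of R (R ⧸ J) ⟶ ModuleCat.of R (R ⧸ I) :=
  ModuleCat.ofHom (Submodule.mapQ J I LinearMap.id h)

theorem exists_stable_annihilator [IsNoetherianRing R] (I : Ideal R) (n : ℕ) (N : ModuleCat.{u} R)
    (P : Ideal R) (hP : P ∈ associatedPrimes R ((localCohomology I n).obj N)) :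
    P.IsPrime ∧ ∃ (k : ℕ) (y : Abelian.Ext (ModuleCat.of R (R ⧸ I ^ k)) N n),
      ∀ (k' : ℕ) (hk : k ≤ k') (r : R),
        r • ((Ext.mk₀ (quotMap (Ideal.pow_le_pow_right hk))).comp y (zero_add n)) = 0 ↔ r ∈ P := by
  rw [AssociatedPrimes.mem_iff, isAssociatedPrime_iff] at hP
  obtain ⟨hprime, x, hx⟩ := hP
  refine ⟨hprime, ?_⟩
  have hx' : ∀ r : R, r • x = 0 ↔ r ∈ P := fun r => by
    rw [hx, Submodule.mem_colon_singleton, Submodule.mem_bot]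
  let F : (ℕᵒᵖ)ᵒᵖ ⥤ ModuleCat.{u} R := localCohomology.diagram (localCohomology.idealPowersDiagram I) n ⋙
    (evaluation _ _).obj N
  have := localCohomology.hasColimitDiagram (localCohomology.idealPowersDiagram I) n
  let c : Cocone F := ((evaluation _ _).obj N).mapCocone
    (colimit.cocone (localCohomology.diagram (localCohomology.idealPowersDiagram I) n))
  have hc : IsColimit c := isColimitOfPreserves _ (colimit.isColimit _)
  have : PreservesFilteredColimitsOfSize.{0, 0} (forget (ModuleCat.{u} R)) :=
    preservesFilteredColimitsOfSize_shrink.{0, u, 0, u} _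
  have : PreservesColimitsOfShape (ℕᵒᵖ)ᵒᵖ (forget (ModuleCat.{u} R)) :=
    PreservesFilteredColimitsOfSize.preserves_filtered_colimits _
  obtain ⟨j, y0, hy0⟩ := Concrete.isColimit_exists_rep F hc x
  have step : ∀ r ∈ P, ∃ k : ℕ, ∀ k' (f : j ⟶ op (op k')), k ≤ k' → r • F.map f y0 = 0 := by
    intro r hr
    have h0 : c.ι.app j (r • y0) = c.ι.app j 0 := by
      rw [map_smul, map_zero]
      rw [hy0]
      exact (hx' r).2 hr
    obtain ⟨l, f, g, hfg⟩ := (Concrete.isColimit_rep_eq_iff_exists F hc _ _).1 h0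
    rw [map_zero, map_smul] at hfg
    refine ⟨l.unop.unop, fun k' f' hk => ?_⟩
    let t : l ⟶ op (op k') := (homOfLE hk).op.op
    have : f' = f ≫ t := Subsingleton.elim _ _
    rw [this, F.map_comp, ModuleCat.comp_apply, ← map_smul, hfg, map_zero]
  obtain ⟨s, hs⟩ := (isNoetherianRing_iff_ideal_fg R).1 inferInstance P
  have hsP : ∀ r : s, (r : R) ∈ P := fun r => hs ▸ Ideal.subset_span r.2
  choose kk hkk using fun r : s => step r (hsP r)
  let k := max j.unop.unop (Finset.univ.sup kk)
  let jk : j ⟶ op (op k) := (homOfLE (le_max_left _ _)).op.op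
  let y1 : F.obj (op (op k)) := F.map jk y0
  let e (m : ℕ) : F.obj (op (op m)) ≃ₗ[R] Abelian.Ext (ModuleCat.of R (R ⧸ I ^ m)) N n :=
    extEquiv n (ModuleCat.of R (R ⧸ I ^ m)) N
  refine ⟨k, e k y1, fun k' hk r => ?_⟩
  let t : (op (op k) : (ℕᵒᵖ)ᵒᵖ) ⟶ op (op k') := (homOfLE hk).op.op
  have key : (Ext.mk₀ (quotMap (Ideal.pow_le_pow_right hk))).comp (e k y1) (zero_add n) =
      e k' (F.map t y1) :=
    (extEquiv_extCatMap (quotMap (Ideal.pow_le_pow_right hk)) N n y1).symm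
  rw [key, ← map_smul, LinearEquiv.map_eq_zero_iff]
  have hyt : F.map t y1 = F.map (jk ≫ t) y0 := by
    rw [F.map_comp, ModuleCat.comp_apply]
  have hct : c.ι.app _ (F.map t y1) = x := by
    have := congr($(c.w (jk ≫ t)).hom y0)
    rw [hyt, ← hy0]
    exact this
  constructor
  · intro h
    rw [← hx' r, ← hct]
    have h1 := congrArg (c.ι.app (op (op k'))).hom h
    rw [map_smul, map_zero] at h1
    exact h1
  · intro hr
    suffices P ≤ LinearMap.ker (LinearMap.toSpanSingleton R _ (F.map t y1)) from this hr
    rw [← hs]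
    refine Ideal.span_le.2 fun a ha => ?_
    change a • F.map t y1 = 0
    rw [hyt]
    exact hkk ⟨a, ha⟩ k' _ ((Finset.le_sup (Finset.mem_univ (⟨a, ha⟩ : s))).trans
      ((le_max_right _ _).trans hk))

end LocCoh

namespace ExtTools
open Abelian Limits

variable {R : Type u} [CommRing R]

/-- A short exact sequence starting with `Z` and having an injective middle term. -/
noncomputable def injShort (Z : ModuleCat.{u} R) : ShortComplex (ModuleCat.{u} R) :=
  ShortComplex.mk (Injective.ι Z) (cokernel.π (Injective.ι Z)) (by simp)

lemma injShort_shortExact (Z : ModuleCat.{u} R) : (injShort Z).ShortExact where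
  exact := ShortComplex.exact_cokernel _
  mono_f := by dsimp [injShort]; infer_instance
  epi_g := by dsimp [injShort]; infer_instance

instance (Z : ModuleCat.{u} R) : Injective (injShort Z).X₂ := by
  dsimp [injShort]; infer_instance

lemma exists_injective_shortExact (Z : ModuleCat.{u} R) :
    ∃ S : ShortComplex (ModuleCat.{u} R), S.ShortExact ∧ Injective S.X₂ ∧ S.X₁ = Z :=
  ⟨injShort Z, injShort_shortExact Z, inferInstance, rfl⟩

lemma subsingleton_ext_injective (X E : ModuleCat.{u} R) [Injective E] (n : ℕ) :
    Subsingleton (Ext X E (n + 1)) :=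
  subsingleton_of_forall_eq 0 fun _ => Ext.eq_zero_of_injective _

lemma subsingleton_ext_X₃ {S : ShortComplex (ModuleCat.{u} R)} (hS : S.ShortExact)
    (X : ModuleCat.{u} R) (n : ℕ) (h2 : Subsingleton (Ext X S.X₂ n))
    (h1 : Subsingleton (Ext X S.X₁ (n + 1))) : Subsingleton (Ext X S.X₃ n) :=
  subsingleton_of_forall_eq 0 fun x => by
    obtain ⟨y, rfl⟩ := Ext.covariant_sequence_exact₃ X hS x rfl (Subsingleton.elim _ _)
    rw [Subsingleton.elim y 0, Ext.zero_comp]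

/-- Apply `Hom(C, -)` to a short complex. -/
noncomputable abbrev homShort (C : ModuleCat.{u} R) (S : ShortComplex (ModuleCat.{u} R)) :
    ShortComplex (ModuleCat.{u} R) where
  X₁ := ModuleCat.of R (C →ₗ[R] S.X₁)
  X₂ := ModuleCat.of R (C →ₗ[R] S.X₂)
  X₃ := ModuleCat.of R (C →ₗ[R] S.X₃)
  f := ModuleCat.ofHom (LinearMap.compRight R S.f.hom)
  g := ModuleCat.ofHom (LinearMap.compRight R S.g.hom)
  zero := by
    ext f x
    exact congr($(S.zero).hom (f x))

lemma homShort_shortExact (C : ModuleCat.{u} R) {S : ShortComplex (ModuleCat.{u} R)}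
    (hS : S.ShortExact) (h1 : Subsingleton (Ext C S.X₁ 1)) : (homShort C S).ShortExact := by
  have hm := hS.mono_f
  have he := hS.epi_g
  refine ModuleCat.shortComplex_shortExact _ ?_ ?_ ?_
  · intro (f : C →ₗ[R] S.X₂)
    constructor
    · intro h
      have h0 : LinearMap.compRight R S.g.hom f = 0 := h
      have h' : ModuleCat.ofHom f ≫ S.g = 0 := by
        ext x
        exact LinearMap.congr_fun h0 x
      refine ⟨(hS.exact.lift _ h').hom, ?_⟩
      exact congr($(hS.exact.lift_f _ h').hom)
    · rintro ⟨g, rfl⟩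
      exact congr($((homShort C S).zero).hom g)
  · intro (f : C →ₗ[R] S.X₁) (g : C →ₗ[R] S.X₁) h
    have h0 : LinearMap.compRight R S.f.hom f = LinearMap.compRight R S.f.hom g := h
    have h' : ModuleCat.ofHom f ≫ S.f = ModuleCat.ofHom g ≫ S.f := by
      ext x
      exact LinearMap.congr_fun h0 x
    exact congr($((cancel_mono S.f).1 h').hom)
  · intro f
    obtain ⟨y, hy⟩ := Ext.covariant_sequence_exact₃ C hS (Ext.mk₀ (ModuleCat.ofHom f)) (zero_add 1)
      (Subsingleton.elim _ _)
    obtain ⟨g, rfl⟩ := (Ext.mk₀_bijective C S.X₂).2 y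
    rw [Ext.mk₀_comp_mk₀] at hy
    refine ⟨g.hom, ?_⟩
    exact congr($((Ext.mk₀_bijective C S.X₃).1 hy).hom)

/-- Apply `Hom(-, E)` to a short complex. -/
noncomputable abbrev contraHomShort (E : ModuleCat.{u} R) (S : ShortComplex (ModuleCat.{u} R)) :
    ShortComplex (ModuleCat.{u} R) where
  X₁ := ModuleCat.of R (S.X₃ →ₗ[R] E)
  X₂ := ModuleCat.of R (S.X₂ →ₗ[R] E)
  X₃ := ModuleCat.of R (S.X₁ →ₗ[R] E)
  f := ModuleCat.ofHom (LinearMap.lcomp R E S.g.hom)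
  g := ModuleCat.ofHom (LinearMap.lcomp R E S.f.hom)
  zero := by
    ext f x
    have : S.g.hom (S.f.hom x) = 0 := congr($(S.zero).hom x)
    change f (S.g.hom (S.f.hom x)) = 0
    rw [this, map_zero]

lemma contraHomShort_shortExact (E : ModuleCat.{u} R) [Injective E]
    {S : ShortComplex (ModuleCat.{u} R)}
    (hS : S.ShortExact) : (contraHomShort E S).ShortExact := by
  have hm := hS.mono_f
  have he := hS.epi_g
  refine ModuleCat.shortComplex_shortExact _ ?_ ?_ ?_
  · intro (f : S.X₂ →ₗ[R] E)
    constructor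
    · intro h
      have h0 : LinearMap.lcomp R E S.f.hom f = 0 := h
      have h' : S.f ≫ ModuleCat.ofHom f = 0 := by
        ext x
        exact LinearMap.congr_fun h0 x
      exact ⟨(hS.exact.desc _ h').hom, congr($(hS.exact.g_desc _ h').hom)⟩
    · rintro ⟨g, rfl⟩
      exact congr($((contraHomShort E S).zero).hom g)
  · intro (f : S.X₃ →ₗ[R] E) (g : S.X₃ →ₗ[R] E) h
    have h0 : LinearMap.lcomp R E S.g.hom f = LinearMap.lcomp R E S.g.hom g := h
    have h' : S.g ≫ ModuleCat.ofHom f = S.g ≫ ModuleCat.ofHom g := by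
      ext x
      exact LinearMap.congr_fun h0 x
    exact congr($((cancel_epi S.g).1 h').hom)
  · intro f
    exact ⟨(Injective.factorThru (ModuleCat.ofHom f) S.f).hom,
      congr($(Injective.comp_factorThru (ModuleCat.ofHom f) S.f).hom)⟩

lemma injective_hom_free (E : ModuleCat.{u} R) [hE : Injective E] (m : ℕ) :
    Injective (ModuleCat.of R ((Fin m → R) →ₗ[R] E)) := by
  have h1 : Module.Injective R E := (Module.injective_iff_injective_object R E).2 hE
  have h2 : Injective (ModuleCat.of R (Fin m → E)) :=
    Module.injective_object_of_injective_module R (Fin m → E)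
  exact Injective.of_iso ((Pi.basisFun R (Fin m)).constr R).toModuleIso h2

end ExtTools

namespace LocCoh
open Abelian Limits ExtTools

variable {R : Type u} [CommRing R]

/-- Restriction of an extension class along `R ⧸ J → R ⧸ I`. -/
noncomputable abbrev restr {J I : Ideal R} (h : J ≤ I) {Y : ModuleCat.{u} R} {n : ℕ}
    (y : Ext (ModuleCat.of R (R ⧸ I)) Y n) : Ext (ModuleCat.of R (R ⧸ J)) Y n :=
  (Ext.mk₀ (quotMap h)).comp y (zero_add n)

lemma quotMap_comp {K J I : Ideal R} (h : K ≤ J) (h' : J ≤ I) :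
    quotMap h ≫ quotMap h' = quotMap (h.trans h') := by
  ext
  rfl

lemma restr_restr {K J I : Ideal R} (h : K ≤ J) (h' : J ≤ I) {Y : ModuleCat.{u} R} {n : ℕ}
    (y : Ext (ModuleCat.of R (R ⧸ I)) Y n) : restr h (restr h' y) = restr (h.trans h') y := by
  rw [restr, restr, restr, Ext.mk₀_comp_mk₀_assoc, quotMap_comp]

lemma restr_comp {J I : Ideal R} (h : J ≤ I) {Y Z : ModuleCat.{u} R} {n m l : ℕ}
    (y : Ext (ModuleCat.of R (R ⧸ I)) Y n) (z : Ext Y Z m) (hl : n + m = l) :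
    restr h (y.comp z hl) = (restr h y).comp z hl := by
  exact (Ext.comp_assoc _ _ _ _ _ (by lia)).symm

lemma restr_smul {J I : Ideal R} (h : J ≤ I) {Y : ModuleCat.{u} R} {n : ℕ} (r : R)
    (y : Ext (ModuleCat.of R (R ⧸ I)) Y n) : restr h (r • y) = r • restr h y := by
  rw [restr, restr, Ext.comp_smul]

lemma restr_zero {J I : Ideal R} (h : J ≤ I) {Y : ModuleCat.{u} R} {n : ℕ} :
    restr h (0 : Ext (ModuleCat.of R (R ⧸ I)) Y n) = 0 := by
  rw [restr, Ext.comp_zero]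

/-- The map `R ⧸ J → M` sending `1` to an element killed by `J`. -/
noncomputable def quotElem (J : Ideal R) {M : ModuleCat.{u} R} (m : M) (h : ∀ r ∈ J, r • m = 0) :
    ModuleCat.of R (R ⧸ J) ⟶ M :=
  ModuleCat.ofHom (Submodule.liftQ J (LinearMap.toSpanSingleton R M m) h)

lemma quotElem_one (J : Ideal R) {M : ModuleCat.{u} R} (m : M) (h : ∀ r ∈ J, r • m = 0) :
    (quotElem J m h).hom (Ideal.Quotient.mk J 1) = m :=
  one_smul R m

lemma quot_hom_ext {J : Ideal R} {M : ModuleCat.{u} R} {f g : ModuleCat.of R (R ⧸ J) ⟶ M}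
    (h : f.hom (Ideal.Quotient.mk J 1) = g.hom (Ideal.Quotient.mk J 1)) : f = g := by
  ext : 1
  refine Submodule.linearMap_qext _ ?_
  ext
  exact h

lemma smul_hom_one {J : Ideal R} {M : ModuleCat.{u} R} (f : ModuleCat.of R (R ⧸ J) ⟶ M) (r : R)
    (hr : r ∈ J) : r • f.hom (Ideal.Quotient.mk J 1) = 0 := by
  rw [← map_smul]
  have : r • (Ideal.Quotient.mk J 1) = 0 := by
    rw [← Ideal.Quotient.mk_eq_mk, ← Submodule.Quotient.mk_smul, smul_eq_mul, mul_one]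
    exact (Submodule.Quotient.mk_eq_zero _).2 hr
  exact (congrArg f.hom this).trans (map_zero _)

lemma artinRees_extend [IsNoetherianRing R] (E : ModuleCat.{u} R) [hE : Injective E]
    (I : Ideal R) (k m : ℕ) (K : Submodule R (Fin m → R)) (η : K →ₗ[R] E)
    (hη : ∀ r ∈ I ^ k, r • η = 0) :
    ∃ k', k ≤ k' ∧ ∃ ζ : (Fin m → R) →ₗ[R] E, (∀ r ∈ I ^ k', r • ζ = 0) ∧ ζ ∘ₗ K.subtype = η := by
  obtain ⟨c, hc⟩ := Ideal.exists_pow_inf_eq_pow_smul I K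
  refine ⟨c + k, by omega, ?_⟩
  have hinc := hc (c + k) (by omega)
  set L : Submodule R (Fin m → R) := I ^ (c + k) • ⊤ with hL
  have hker : ∀ x : K, (x : Fin m → R) ∈ L → η x = 0 := by
    intro x hx
    have h1 : (x : Fin m → R) ∈ I ^ k • K := by
      have : (x : Fin m → R) ∈ L ⊓ K := ⟨hx, x.2⟩
      rw [hinc, Nat.add_sub_cancel_left] at this
      exact Submodule.smul_mono le_rfl inf_le_right this
    have h2 : I ^ k • K ≤ (LinearMap.ker η).map K.subtype := by
      rw [Submodule.smul_le]
      intro r hr y hy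
      refine ⟨r • ⟨y, hy⟩, ?_, rfl⟩
      have := LinearMap.congr_fun (hη r hr) ⟨y, hy⟩
      rw [LinearMap.smul_apply, LinearMap.zero_apply] at this
      exact (map_smul η r _).trans this
    obtain ⟨z, hz, hzx⟩ := h2 h1
    rwa [← Subtype.ext hzx]
  -- extend along `K / (K ∩ L) → F / L`
  let j : (K ⧸ L.comap K.subtype) →ₗ[R] (Fin m → R) ⧸ L := Submodule.mapQ _ _ K.subtype le_rfl
  have hj : Function.Injective j := by
    rw [← LinearMap.ker_eq_bot]
    refine (Submodule.ker_liftQ _ _ _).trans ?_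
    rw [LinearMap.ker_comp, Submodule.ker_mkQ, Submodule.mkQ_map_self]
  let η' : (K ⧸ L.comap K.subtype) →ₗ[R] E := Submodule.liftQ _ η fun x hx => hker x hx
  have h1 : Module.Injective R E := (Module.injective_iff_injective_object R E).2 hE
  obtain ⟨ζ, hζ⟩ := h1.out j hj η'
  refine ⟨ζ ∘ₗ L.mkQ, ?_, ?_⟩
  · intro r hr
    ext i
    have : L.mkQ (r • Pi.single i 1) = 0 := by
      rw [Submodule.mkQ_apply, Submodule.Quotient.mk_eq_zero]
      exact Submodule.smul_mem_smul hr trivial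
    have h2 := congrArg ζ this
    rw [map_smul, map_smul, map_zero] at h2
    exact h2
  · ext x
    exact hζ (Submodule.Quotient.mk x)

theorem exists_restr_eq_zero [IsNoetherianRing R] (I : Ideal R) (E : ModuleCat.{u} R)
    [hE : Injective E] (i : ℕ) : ∀ (N : ModuleCat.{u} R) (_ : Module.Finite R N) (k : ℕ)
      (x : Ext (ModuleCat.of R (R ⧸ I ^ k)) (ModuleCat.of R (N →ₗ[R] E)) (i + 1)),
      ∃ (k' : ℕ) (hk : k ≤ k'), restr (Ideal.pow_le_pow_right hk) x = 0 := by
  induction i with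
  | zero =>
    intro N hN k x
    obtain ⟨m, f, hf⟩ := Module.Finite.exists_fin' R N
    have hT := LinearMap.shortExact_shortComplexKer hf
    have hS := contraHomShort_shortExact E hT
    have : Injective (contraHomShort E f.shortComplexKer).X₂ := injective_hom_free E m
    obtain ⟨h, hx⟩ := Ext.covariant_sequence_exact₁ _ hS x (Ext.eq_zero_of_injective _) (zero_add _)
    obtain ⟨h, rfl⟩ := (Ext.mk₀_bijective _ _).2 h
    let η : LinearMap.ker f →ₗ[R] E := h.hom (Ideal.Quotient.mk _ 1)
    obtain ⟨k', hk, ζ, hζ, hζη⟩ := artinRees_extend E I k m (LinearMap.ker f) η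
      (fun r hr => smul_hom_one h r hr)
    refine ⟨k', hk, ?_⟩
    have key : quotMap (Ideal.pow_le_pow_right hk) ≫ h =
        quotElem (I ^ k') (M := (contraHomShort E f.shortComplexKer).X₂) ζ hζ ≫
          (contraHomShort E f.shortComplexKer).g := by
      refine quot_hom_ext ?_
      have h1 := congrArg (contraHomShort E f.shortComplexKer).g.hom
        (quotElem_one (I ^ k') (M := (contraHomShort E f.shortComplexKer).X₂) ζ hζ)
      exact hζη.symm.trans h1.symm
    refine Eq.trans (congrArg (restr (Y := (contraHomShort E f.shortComplexKer).X₁) _) hx.symm) ?_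
    rw [restr_comp, restr, Ext.mk₀_comp_mk₀, key, ← Ext.mk₀_comp_mk₀,
      Ext.comp_assoc_of_second_deg_zero, hS.comp_extClass, Ext.comp_zero]
  | succ i ih =>
    intro N hN k x
    obtain ⟨m, f, hf⟩ := Module.Finite.exists_fin' R N
    have hT := LinearMap.shortExact_shortComplexKer hf
    have hS := contraHomShort_shortExact E hT
    have : Injective (contraHomShort E f.shortComplexKer).X₂ := injective_hom_free E m
    obtain ⟨y, hx⟩ := Ext.covariant_sequence_exact₁ _ hS x (Ext.eq_zero_of_injective _) rfl
    obtain ⟨k', hk, h⟩ := ih (ModuleCat.of R (LinearMap.ker f)) inferInstance k y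
    refine ⟨k', hk, ?_⟩
    refine Eq.trans (congrArg (restr (Y := (contraHomShort E f.shortComplexKer).X₁) _) hx.symm) ?_
    rw [restr_comp]
    exact (congrArg (fun z => Ext.comp z hS.extClass rfl) h).trans (Ext.zero_comp _ _ _ _ _)

end LocCoh

namespace LocCoh
open Abelian Limits ExtTools

variable {R : Type u} [CommRing R]

/-- The annihilator of `y` is `P`, and remains so after all restrictions along powers of `I`. -/
def StableAnn (I P : Ideal R) {k n : ℕ} {Y : ModuleCat.{u} R}
    (y : Ext (ModuleCat.of R (R ⧸ I ^ k)) Y n) : Prop :=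
  ∀ (k' : ℕ) (hk : k ≤ k') (r : R), r • restr (Ideal.pow_le_pow_right hk) y = 0 ↔ r ∈ P

lemma restr_refl {J : Ideal R} {Y : ModuleCat.{u} R} {n : ℕ}
    (y : Ext (ModuleCat.of R (R ⧸ J)) Y n) : restr le_rfl y = y := by
  have : quotMap (le_refl J) = 𝟙 _ := by
    ext
    rfl
  rw [restr, this, Ext.mk₀_id_comp]

/-- Every class of positive degree with values in `Y` vanishes after restriction. -/
def IndAcyclic (I : Ideal R) (Y : ModuleCat.{u} R) : Prop :=
  ∀ (k i : ℕ) (x : Ext (ModuleCat.of R (R ⧸ I ^ k)) Y (i + 1)),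
      ∃ (k' : ℕ) (hk : k ≤ k'), restr (Ideal.pow_le_pow_right hk) x = 0

lemma exists_comp_extClass {I : Ideal R} {S : ShortComplex (ModuleCat.{u} R)} (hS : S.ShortExact)
    (h2 : IndAcyclic I S.X₂) {k n : ℕ}
    (y : Ext (ModuleCat.of R (R ⧸ I ^ k)) S.X₁ (n + 1)) :
    ∃ (k' : ℕ) (hk : k ≤ k') (y' : Ext (ModuleCat.of R (R ⧸ I ^ k')) S.X₃ n),
      y'.comp hS.extClass rfl = restr (Ideal.pow_le_pow_right hk) y := by
  obtain ⟨k', hk, h⟩ := h2 k n (y.comp (Ext.mk₀ S.f) (add_zero _))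
  rw [restr_comp] at h
  obtain ⟨y', hy'⟩ := Ext.covariant_sequence_exact₁ _ hS _ h rfl
  exact ⟨k', hk, y', hy'⟩

lemma exists_stableAnn_shift [IsNoetherianRing R] {I P : Ideal R}
    {S : ShortComplex (ModuleCat.{u} R)} (hS : S.ShortExact)
    (h2 : IndAcyclic I S.X₂) {k n : ℕ}
    (y : Ext (ModuleCat.of R (R ⧸ I ^ k)) S.X₁ (n + 2)) (hy : StableAnn I P y) :
    ∃ (k' : ℕ) (y' : Ext (ModuleCat.of R (R ⧸ I ^ k')) S.X₃ (n + 1)), StableAnn I P y' := by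
  obtain ⟨k2, hk2, y', hy'⟩ := exists_comp_extClass hS h2 y
  have step : ∀ r ∈ P, ∃ k3, ∃ hk : k2 ≤ k3, r • restr (Ideal.pow_le_pow_right hk) y' = 0 := by
    intro r hr
    have h0 : (r • y').comp hS.extClass rfl = 0 := by
      rw [Ext.smul_comp, hy', hy k2 hk2 r]
      exact hr
    obtain ⟨w, hw⟩ := Ext.covariant_sequence_exact₃ _ hS _ _ h0
    obtain ⟨k3, hk3, h3⟩ := h2 k2 n w
    refine ⟨k3, hk3, ?_⟩
    rw [← restr_smul, ← hw, restr_comp, h3, Ext.zero_comp]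
  choose! K hK hK' using step
  obtain ⟨s, hs⟩ := IsNoetherian.noetherian P
  have hsP : ∀ r ∈ s, r ∈ P := fun r hr => hs ▸ Submodule.subset_span hr
  let k3 := max k2 (s.sup K)
  have hk3 : k2 ≤ k3 := le_max_left _ _
  refine ⟨k3, restr (Ideal.pow_le_pow_right hk3) y', fun k' hk r => ?_⟩
  rw [restr_restr]
  constructor
  · intro h
    rw [← hy k' (hk2.trans (hk3.trans hk)) r,
      ← restr_restr (Ideal.pow_le_pow_right (hk3.trans hk)) (Ideal.pow_le_pow_right hk2), ← hy',
      restr_comp, ← Ext.smul_comp, h, Ext.zero_comp]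
  · intro hr
    rw [← hs] at hr
    induction hr using Submodule.span_induction with
    | mem r hr =>
      have h1 : K r ≤ k' := (Finset.le_sup hr).trans ((le_max_right _ _).trans hk)
      have h2 := congrArg (restr (Ideal.pow_le_pow_right h1)) (hK' r (hsP r hr))
      rwa [restr_smul, restr_restr, restr_zero] at h2
    | zero => rw [zero_smul]
    | add a b _ _ ha hb => rw [add_smul, ha, hb, add_zero]
    | smul a b _ hb => rw [smul_eq_mul, mul_smul, hb, smul_zero]

lemma exists_hom_of_stableAnn {I P : Ideal R}
    {S : ShortComplex (ModuleCat.{u} R)} (hS : S.ShortExact)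
    (h2 : IndAcyclic I S.X₂) {k : ℕ}
    (y : Ext (ModuleCat.of R (R ⧸ I ^ k)) S.X₁ 1) (hy : StableAnn I P y) :
    ∃ (k' : ℕ) (h : ModuleCat.of R (R ⧸ I ^ k') ⟶ S.X₃),
      ∀ (J : Ideal R) (hJ : J ≤ I ^ k') (m : ℕ) (_ : I ^ m ≤ J) (r : R),
        (∃ t : ModuleCat.of R (R ⧸ J) ⟶ S.X₂, r • (quotMap hJ ≫ h) = t ≫ S.g) ↔ r ∈ P := by
  obtain ⟨k2, hk2, y', hy'⟩ := exists_comp_extClass hS h2 y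
  obtain ⟨h, rfl⟩ := (Ext.mk₀_bijective _ _).2 y'
  refine ⟨k2, h, fun J hJ m hm r => ⟨?_, ?_⟩⟩
  · rintro ⟨t, ht⟩
    let m' := max m k2
    have h1 : I ^ m' ≤ J := (Ideal.pow_le_pow_right (le_max_left _ _)).trans hm
    have h3 : k2 ≤ m' := le_max_right _ _
    rw [← hy m' (hk2.trans h3) r,
      ← restr_restr (Ideal.pow_le_pow_right h3) (Ideal.pow_le_pow_right hk2), ← hy',
      restr_comp, ← Ext.smul_comp, restr, Ext.mk₀_comp_mk₀, ← quotMap_comp h1 hJ,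
      Category.assoc, ← Ext.mk₀_smul, ← Linear.comp_smul, ht, ← Category.assoc,
      ← Ext.mk₀_comp_mk₀, Ext.comp_assoc_of_second_deg_zero, hS.comp_extClass, Ext.comp_zero]
  · intro hr
    have h0 : (Ext.mk₀ (r • h)).comp hS.extClass rfl = 0 := by
      rw [Ext.mk₀_smul, Ext.smul_comp, hy', hy k2 hk2 r]
      exact hr
    obtain ⟨w, hw⟩ := Ext.covariant_sequence_exact₃ _ hS _ _ h0
    obtain ⟨w, rfl⟩ := (Ext.mk₀_bijective _ _).2 w
    rw [Ext.mk₀_comp_mk₀] at hw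
    refine ⟨quotMap hJ ≫ w, ?_⟩
    rw [Category.assoc, (Ext.mk₀_bijective _ _).1 hw, Linear.comp_smul]

variable (C : ModuleCat.{u} R)

/-- The adjunction `Hom(R ⧸ J, Hom(C, Z)) ≃ Hom(C ⧸ J C, Z)`. -/
noncomputable def uncurry (J : Ideal R) {Z : ModuleCat.{u} R}
    (h : ModuleCat.of R (R ⧸ J) ⟶ ModuleCat.of R (C →ₗ[R] Z)) :
    ModuleCat.of R (C ⧸ (J • ⊤ : Submodule R C)) ⟶ Z :=
  ModuleCat.ofHom (Submodule.liftQ _ (h.hom (Ideal.Quotient.mk J 1) : C →ₗ[R] Z) (by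
    rw [Submodule.smul_le]
    intro r hr c _
    rw [LinearMap.mem_ker, map_smul]
    exact LinearMap.congr_fun (smul_hom_one h r hr) c))

lemma uncurry_apply (J : Ideal R) {Z : ModuleCat.{u} R}
    (h : ModuleCat.of R (R ⧸ J) ⟶ ModuleCat.of R (C →ₗ[R] Z)) (c : C) :
    (uncurry C J h).hom (Submodule.Quotient.mk c) = (h.hom (Ideal.Quotient.mk J 1) : C →ₗ[R] Z) c :=
  rfl

lemma uncurry_smul (J : Ideal R) {Z : ModuleCat.{u} R} (r : R)
    (h : ModuleCat.of R (R ⧸ J) ⟶ ModuleCat.of R (C →ₗ[R] Z)) :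
    uncurry C J (r • h) = r • uncurry C J h := by
  ext : 1
  refine Submodule.linearMap_qext _ ?_
  ext
  rfl

lemma uncurry_injective (J : Ideal R) {Z : ModuleCat.{u} R} :
    Function.Injective (uncurry C J (Z := Z)) := by
  intro f g h
  refine quot_hom_ext (LinearMap.ext fun c => ?_)
  rw [← uncurry_apply, ← uncurry_apply, h]

lemma uncurry_surjective (J : Ideal R) {Z : ModuleCat.{u} R} :
    Function.Surjective (uncurry C J (Z := Z)) := by
  intro t
  have key : ∀ r ∈ J, r • (t.hom ∘ₗ (J • ⊤ : Submodule R C).mkQ) = 0 := by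
    intro r hr
    refine LinearMap.ext fun c => ?_
    have h1 : (J • ⊤ : Submodule R C).mkQ (r • c) = 0 := by
      rw [Submodule.mkQ_apply, Submodule.Quotient.mk_eq_zero]
      exact Submodule.smul_mem_smul hr trivial
    have h2 := congrArg t.hom h1
    rw [map_smul, map_smul, map_zero] at h2
    exact h2
  refine ⟨quotElem J (M := ModuleCat.of R (C →ₗ[R] Z)) (t.hom ∘ₗ (J • ⊤ : Submodule R C).mkQ) key,
    ?_⟩
  ext : 1
  refine Submodule.linearMap_qext _ ?_
  exact quotElem_one J (M := ModuleCat.of R (C →ₗ[R] Z)) (t.hom ∘ₗ (J • ⊤ : Submodule R C).mkQ) key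

lemma uncurry_comp (J : Ideal R) {S : ShortComplex (ModuleCat.{u} R)}
    (h : ModuleCat.of R (R ⧸ J) ⟶ (homShort C S).X₂) :
    uncurry C J (Z := S.X₃) (h ≫ (homShort C S).g) = uncurry C J (Z := S.X₂) h ≫ S.g := by
  ext : 1
  refine Submodule.linearMap_qext _ ?_
  ext
  rfl

theorem exists_ext_quot_of_stableAnn [IsNoetherianRing R] [hC : Module.Finite R C] (I P : Ideal R)
    (n : ℕ) : ∀ (Z : ModuleCat.{u} R) (_ : ∀ i, Subsingleton (Ext C Z (i + 1))) (k : ℕ)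
      (y : Ext (ModuleCat.of R (R ⧸ I ^ k)) (ModuleCat.of R (C →ₗ[R] Z)) n)
      (_ : StableAnn I P y),
      ∃ k1, ∀ J ≤ I ^ k1, (∃ m, I ^ m ≤ J) →
        ∃ z : Ext (ModuleCat.of R (C ⧸ (J • ⊤ : Submodule R C))) Z n, ∀ r : R,
          r • z = 0 ↔ r ∈ P := by
  induction n with
  | zero =>
    intro Z _ k y hy
    obtain ⟨h, rfl⟩ := (Ext.mk₀_bijective _ _).2 y
    refine ⟨k, fun J hJ ⟨m, hm⟩ => ⟨Ext.mk₀ (uncurry C J (quotMap hJ ≫ h)), fun r => ?_⟩⟩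
    have h0 : uncurry C J (Z := Z) 0 = 0 := by
      simpa using uncurry_smul C J (0 : R) (Z := Z) 0
    rw [← Ext.mk₀_smul, ← uncurry_smul, Ext.mk₀_eq_zero_iff, ← h0, (uncurry_injective C J).eq_iff]
    constructor
    · intro h1
      have h2 := hy (max m k) (le_max_right _ _) r
      rw [restr, Ext.mk₀_comp_mk₀, ← Ext.mk₀_smul, Ext.mk₀_eq_zero_iff,
        ← quotMap_comp ((Ideal.pow_le_pow_right (le_max_left _ _)).trans hm) hJ,
        Category.assoc, ← Linear.comp_smul, h1, Limits.comp_zero] at h2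
      exact h2.1 rfl
    · intro hr
      have h2 := (hy k le_rfl r).2 hr
      rw [restr_refl, ← Ext.mk₀_smul, Ext.mk₀_eq_zero_iff] at h2
      rw [← Linear.comp_smul, h2, Limits.comp_zero]
  | succ n ih =>
    intro Z hZ k y hy
    obtain ⟨T, hT, hE, rfl⟩ := exists_injective_shortExact Z
    have hS := homShort_shortExact C hT (hZ 0)
    have hac : IndAcyclic I (homShort C T).X₂ := fun k i x =>
      exists_restr_eq_zero I T.X₂ i C hC k x
    have hZ' : ∀ i, Subsingleton (Ext C T.X₃ (i + 1)) := fun i =>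
      subsingleton_ext_X₃ hT _ _ (subsingleton_ext_injective _ _ _) (hZ (i + 1))
    cases n with
    | zero =>
      obtain ⟨k1, h, hh⟩ := exists_hom_of_stableAnn hS hac y hy
      refine ⟨k1, fun J hJ ⟨m, hm⟩ =>
        ⟨(Ext.mk₀ (uncurry C J (Z := T.X₃) (quotMap hJ ≫ h))).comp hT.extClass rfl,
          fun r => ?_⟩⟩
      rw [← hh J hJ m hm r, ← Ext.smul_comp, ← Ext.mk₀_smul, ← uncurry_smul]
      constructor
      · intro h0
        obtain ⟨w, hw⟩ := Ext.covariant_sequence_exact₃ _ hT _ _ h0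
        obtain ⟨w, rfl⟩ := (Ext.mk₀_bijective _ _).2 w
        rw [Ext.mk₀_comp_mk₀] at hw
        obtain ⟨t, rfl⟩ := uncurry_surjective C J w
        refine ⟨t, uncurry_injective C J (Z := T.X₃) ?_⟩
        exact ((Ext.mk₀_bijective _ _).1 hw).symm.trans (uncurry_comp C J t).symm
      · rintro ⟨t, ht⟩
        have := congrArg (uncurry C J (Z := T.X₃)) ht
        have h3 := this.trans (uncurry_comp C J t)
        refine Eq.trans (congrArg (fun a => (Ext.mk₀ a).comp hT.extClass rfl) h3) ?_
        rw [← Ext.mk₀_comp_mk₀, Ext.comp_assoc_of_second_deg_zero, hT.comp_extClass, Ext.comp_zero]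
    | succ n =>
      obtain ⟨k', y', hy'⟩ := exists_stableAnn_shift hS hac y hy
      obtain ⟨k1, h⟩ := ih T.X₃ hZ' k' y' hy'
      refine ⟨k1, fun J hJ hm => ?_⟩
      obtain ⟨z, hz⟩ := h J hJ hm
      refine ⟨z.comp hT.extClass rfl, fun r => ?_⟩
      rw [← hz r, ← Ext.smul_comp]
      constructor
      · intro h0
        obtain ⟨w, hw⟩ := Ext.covariant_sequence_exact₃ _ hT _ _ h0
        rw [← hw, Ext.eq_zero_of_injective w, Ext.zero_comp]
      · intro h0
        rw [h0, Ext.zero_comp]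

end LocCoh

namespace ChangeRings
open Abelian Limits

section Abstract

variable {A B : Type*} [Category* A] [Category* B] [Abelian A] [Abelian B]
  [HasExt.{u} A] [HasExt.{u} B] {G : A ⥤ B} {Co : B ⥤ A} (adj : G ⊣ Co) [G.Additive]
  [PreservesFiniteLimits G] [PreservesFiniteColimits G]

/-- The comparison map `Ext(N, Co K) → Ext(G N, K)` for an exact left adjoint `G` of `Co`. -/
noncomputable def adjExt {N : A} {K : B} {n : ℕ} (x : Ext N (Co.obj K) n) : Ext (G.obj N) K n :=
  (x.mapExactFunctor G).comp (Ext.mk₀ (adj.counit.app K)) (add_zero n)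

lemma adjExt_add {N : A} {K : B} {n : ℕ} (x y : Ext N (Co.obj K) n) :
    adjExt adj (x + y) = adjExt adj x + adjExt adj y := by
  rw [adjExt, Ext.mapExactFunctor_add, Ext.add_comp]; rfl

lemma adjExt_zero {N : A} {K : B} {n : ℕ} : adjExt adj (0 : Ext N (Co.obj K) n) = 0 := by
  rw [adjExt, Ext.mapExactFunctor_zero, Ext.zero_comp]

lemma adjExt_mk₀ {N : A} {K : B} (f : N ⟶ Co.obj K) :
    adjExt adj (Ext.mk₀ f) = Ext.mk₀ ((adj.homEquiv N K).symm f) := by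
  rw [adjExt, Ext.mapExactFunctor_mk₀, Ext.mk₀_comp_mk₀, adj.homEquiv_counit]

lemma adjExt_mk₀_comp {N N' : A} {K : B} {n : ℕ} (g : N' ⟶ N) (x : Ext N (Co.obj K) n) :
    adjExt adj ((Ext.mk₀ g).comp x (zero_add n)) =
      (Ext.mk₀ (G.map g)).comp (adjExt adj x) (zero_add n) := by
  rw [adjExt, Ext.mapExactFunctor_comp, Ext.mapExactFunctor_mk₀, adjExt,
    Ext.comp_assoc_of_third_deg_zero]

lemma adjExt_comp_mk₀ {N : A} {K K' : B} {n : ℕ} (g : K ⟶ K') (x : Ext N (Co.obj K) n) :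
    adjExt adj (x.comp (Ext.mk₀ (Co.map g)) (add_zero n)) =
      (adjExt adj x).comp (Ext.mk₀ g) (add_zero n) := by
  rw [adjExt, Ext.mapExactFunctor_comp, Ext.mapExactFunctor_mk₀, adjExt,
    Ext.comp_assoc_of_third_deg_zero, Ext.comp_assoc_of_third_deg_zero, Ext.mk₀_comp_mk₀,
    Ext.mk₀_comp_mk₀, ← adj.counit_naturality]

/-- The counit as a morphism of short complexes. -/
def counitShort [Co.PreservesZeroMorphisms] (T : ShortComplex B) : (T.map Co).map G ⟶ T where
  τ₁ := adj.counit.app _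
  τ₂ := adj.counit.app _
  τ₃ := adj.counit.app _
  comm₁₂ := (adj.counit_naturality _).symm
  comm₂₃ := (adj.counit_naturality _).symm

lemma adjExt_comp_extClass [Co.PreservesZeroMorphisms] {N : A} {T : ShortComplex B}
    (hT : T.ShortExact)
    (hCo : (T.map Co).ShortExact) {n : ℕ} (x : Ext N (Co.obj T.X₃) n) :
    adjExt adj (x.comp hCo.extClass rfl : Ext N (Co.obj T.X₁) (n + 1)) =
      (adjExt adj x).comp hT.extClass rfl := by
  refine Eq.trans ?_ (Ext.comp_assoc_of_second_deg_zero (x.mapExactFunctor G)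
    (Ext.mk₀ (adj.counit.app T.X₃)) hT.extClass rfl).symm
  refine Eq.trans ?_ (congrArg (fun z => (x.mapExactFunctor G).comp z rfl)
    (ShortComplex.ShortExact.extClass_naturality (hCo.map_of_exact G) hT (counitShort adj T)))
  have h1 := Ext.mapExactFunctor_extClass G hCo
  refine Eq.trans ?_ (congrArg (fun z => (x.mapExactFunctor G).comp
    (Ext.comp z (Ext.mk₀ (adj.counit.app T.X₁)) (add_zero 1)) rfl) h1)
  refine Eq.trans ?_ (Ext.comp_assoc _ _ _ rfl _ (by lia))
  exact congrArg (fun z => Ext.comp z (Ext.mk₀ (adj.counit.app T.X₁)) (add_zero _))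
    (Ext.mapExactFunctor_comp G x hCo.extClass rfl)

theorem adjExt_bijective [Co.PreservesZeroMorphisms] [EnoughInjectives B] (Q : B → Prop)
    (hinj : ∀ E, Injective E → Q E)
    (hQ : ∀ (T : ShortComplex B), T.ShortExact → Injective T.X₂ → Q T.X₁ →
      Q T.X₃ ∧ (T.map Co).ShortExact) (n : ℕ) :
    ∀ (N : A) (K : B) (_ : Q K),
      Function.Bijective (adjExt adj : Ext N (Co.obj K) n → Ext (G.obj N) K n) := by
  induction n with
  | zero =>
    intro N K _
    constructor
    · intro x y h
      obtain ⟨x, rfl⟩ := (Ext.mk₀_bijective _ _).2 x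
      obtain ⟨y, rfl⟩ := (Ext.mk₀_bijective _ _).2 y
      rw [adjExt_mk₀, adjExt_mk₀] at h
      rw [(adj.homEquiv N K).symm.injective ((Ext.mk₀_bijective _ _).1 h)]
    · intro x
      obtain ⟨x, rfl⟩ := (Ext.mk₀_bijective _ _).2 x
      refine ⟨Ext.mk₀ (adj.homEquiv N K x), ?_⟩
      rw [adjExt_mk₀, Equiv.symm_apply_apply]
  | succ n ih =>
    intro N K hK
    obtain ⟨T, hT, hE, rfl⟩ : ∃ T : ShortComplex B, T.ShortExact ∧ Injective T.X₂ ∧ T.X₁ = K :=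
      ⟨ShortComplex.mk (Injective.ι K) (cokernel.π (Injective.ι K)) (by simp),
        { exact := ShortComplex.exact_cokernel _
          mono_f := by dsimp; infer_instance
          epi_g := by dsimp; infer_instance }, by dsimp; infer_instance, rfl⟩
    obtain ⟨hQ3, hCo⟩ := hQ T hT hE hK
    have hE' : Injective (T.map Co).X₂ := by
      have : G.PreservesMonomorphisms := inferInstance
      exact Injective.injective_of_adjoint adj T.X₂
    constructor
    · refine (injective_iff_map_eq_zero (AddMonoidHom.mk' _ (adjExt_add adj))).2 fun x hx => ?_
      obtain ⟨x', rfl⟩ := Ext.covariant_sequence_exact₁ N hCo x (Ext.eq_zero_of_injective _) rfl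
      have hx2 : (adjExt adj x').comp hT.extClass rfl = 0 :=
        (adjExt_comp_extClass adj hT hCo x').symm.trans hx
      obtain ⟨w, hw⟩ := Ext.covariant_sequence_exact₃ _ hT _ _ hx2
      obtain ⟨w, rfl⟩ := (ih N T.X₂ (hinj _ hE)).2 w
      rw [← adjExt_comp_mk₀] at hw
      refine (congrArg (fun z => Ext.comp z hCo.extClass rfl) ((ih N T.X₃ hQ3).1 hw)).symm.trans ?_
      refine (Ext.comp_assoc_of_second_deg_zero (Z := (T.map Co).X₃) w (Ext.mk₀ (T.map Co).g)
        hCo.extClass rfl).trans ?_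
      exact (congrArg (fun z => w.comp z rfl) hCo.comp_extClass).trans (Ext.comp_zero _ _ _ _ _)
    · intro x
      obtain ⟨x', rfl⟩ := Ext.covariant_sequence_exact₁ _ hT x (Ext.eq_zero_of_injective _) rfl
      obtain ⟨x', rfl⟩ := (ih N T.X₃ hQ3).2 x'
      exact ⟨_, adjExt_comp_extClass adj hT hCo x'⟩

end Abstract

end ChangeRings

namespace ChangeRings
open Abelian Limits ExtTools

variable {R S : Type u} [CommRing R] [CommRing S] (φ : R →+* S)

/-- `S` as an `R`-module. -/
noncomputable abbrev resSelf : ModuleCat.{u} R :=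
  (ModuleCat.restrictScalars φ).obj (ModuleCat.of S S)

/-- The modules which are acyclic for coextension of scalars along `φ`. -/
def CoAcyclic (K : ModuleCat.{u} R) : Prop := ∀ i, Subsingleton (Ext (resSelf φ) K (i + 1))

instance : (ModuleCat.coextendScalars.{u, u, u} φ).Additive where
  map_add := by
    intros
    ext
    rfl

lemma coextend_shortExact {T : ShortComplex (ModuleCat.{u} R)} (hT : T.ShortExact)
    (h1 : Subsingleton (Ext (resSelf φ) T.X₁ 1)) :
    (T.map (ModuleCat.coextendScalars.{u, u, u} φ)).ShortExact := by
  have hS := homShort_shortExact (resSelf φ) hT h1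
  have := hS.mono_f
  have := hS.epi_g
  refine ModuleCat.shortComplex_shortExact _ ?_ ?_ ?_
  · exact (ShortComplex.ShortExact.moduleCat_exact_iff_function_exact (homShort (resSelf φ) T)).1
      hS.exact
  · exact (ModuleCat.mono_iff_injective (homShort (resSelf φ) T).f).1 inferInstance
  · exact (ModuleCat.epi_iff_surjective (homShort (resSelf φ) T).g).1 inferInstance

variable {φ} in
theorem coextExt_bijective {K : ModuleCat.{u} R} (hK : CoAcyclic φ K) (N : ModuleCat.{u} S) (n : ℕ) :
    Function.Bijective (adjExt (ModuleCat.restrictCoextendScalarsAdj.{u, u, u} φ) :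
      Ext N ((ModuleCat.coextendScalars.{u, u, u} φ).obj K) n →
        Ext ((ModuleCat.restrictScalars φ).obj N) K n) := by
  refine adjExt_bijective _ (CoAcyclic φ) ?_ ?_ n N K hK
  · intro E hE i
    exact subsingleton_ext_injective _ _ _
  · intro T hT hE h
    exact ⟨fun i => subsingleton_ext_X₃ hT _ _ (subsingleton_ext_injective _ _ _) (h (i + 1)),
      coextend_shortExact φ hT (h 0)⟩

lemma coextExt_smul {K : ModuleCat.{u} R} {N : ModuleCat.{u} S} {n : ℕ} (r : R)
    (x : Ext N ((ModuleCat.coextendScalars.{u, u, u} φ).obj K) n) :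
    adjExt (ModuleCat.restrictCoextendScalarsAdj.{u, u, u} φ) (φ r • x) =
      r • adjExt (ModuleCat.restrictCoextendScalarsAdj.{u, u, u} φ) x := by
  have h1 : φ r • x = (Ext.mk₀ (φ r • 𝟙 N)).comp x (zero_add n) := by
    rw [Ext.mk₀_smul, Ext.smul_comp, Ext.mk₀_id_comp]
  have h2 : (ModuleCat.restrictScalars φ).map (φ r • 𝟙 N) = r • 𝟙 _ := by
    ext x
    rfl
  rw [h1, adjExt_mk₀_comp, h2, Ext.mk₀_smul, Ext.smul_comp, Ext.mk₀_id_comp]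

end ChangeRings

namespace LocExt
open Abelian Limits ExtTools

variable {R : Type u} [CommRing R] (S : Submonoid R)

/-- Localization of extension classes. -/
noncomputable def locExt {N K : ModuleCat.{u} R} {n : ℕ} (x : Ext N K n) :
    Ext (N.localizedModule S) (K.localizedModule S) n :=
  x.mapExactFunctor (ModuleCat.localizedModuleFunctor.{u} S)

lemma localizedModuleMap_mk {N K : ModuleCat.{u} R} (f : N ⟶ K) (x : N) :
    (ModuleCat.localizedModuleMap S f).hom (N.localizedModuleMkLinearMap S x) =
      K.localizedModuleMkLinearMap S (f.hom x) :=
  IsLocalizedModule.map_apply S (N.localizedModuleMkLinearMap S) (K.localizedModuleMkLinearMap S)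
    f.hom x

lemma localizedModule_hom_ext {N : ModuleCat.{u} R} {K : ModuleCat.{u} (Localization S)}
    {f g : N.localizedModule S ⟶ K}
    (h : ∀ x : N, f.hom (N.localizedModuleMkLinearMap S x) =
      g.hom (N.localizedModuleMkLinearMap S x)) : f = g := by
  ext y
  obtain ⟨⟨x, s⟩, hx⟩ := IsLocalizedModule.surj S (N.localizedModuleMkLinearMap S) y
  have hu : IsUnit (algebraMap R (Localization S) s) := IsLocalization.map_units _ s
  have e : (s : R) • y = algebraMap R (Localization S) s • y := (algebraMap_smul _ _ _).symm
  have h2 : algebraMap R (Localization S) s • f.hom y = algebraMap R (Localization S) s • g.hom y := by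
    rw [← map_smul, ← map_smul, ← e]
    have hx' : (s : R) • y = N.localizedModuleMkLinearMap S x := hx
    rw [hx']
    exact h x
  exact hu.smul_left_cancel.1 h2

lemma localizedModuleMap_smul_id (N : ModuleCat.{u} R) (r : R) :
    ModuleCat.localizedModuleMap S (r • 𝟙 N) =
      algebraMap R (Localization S) r • 𝟙 (N.localizedModule S) := by
  refine localizedModule_hom_ext S fun x => ?_
  rw [localizedModuleMap_mk]
  refine (map_smul (N.localizedModuleMkLinearMap S) r x).trans ?_
  exact (algebraMap_smul (Localization S) r (N.localizedModuleMkLinearMap S x)).symm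

lemma smul_eq_mk₀_comp {A : Type u} [CommRing A] {N K : ModuleCat.{u} A} {n : ℕ} (r : A)
    (x : Ext N K n) : r • x = (Ext.mk₀ (r • 𝟙 N)).comp x (zero_add n) := by
  rw [Ext.mk₀_smul, Ext.smul_comp, Ext.mk₀_id_comp]

lemma locExt_smul {N K : ModuleCat.{u} R} {n : ℕ} (r : R) (x : Ext N K n) :
    locExt S (r • x) = algebraMap R (Localization S) r • locExt S x := by
  rw [smul_eq_mk₀_comp, smul_eq_mk₀_comp, locExt, Ext.mapExactFunctor_comp,
    Ext.mapExactFunctor_mk₀, ← localizedModuleMap_smul_id]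
  rfl

lemma locExt_add {N K : ModuleCat.{u} R} {n : ℕ} (x y : Ext N K n) :
    locExt S (x + y) = locExt S x + locExt S y :=
  Ext.mapExactFunctor_add _ _ _ _ _ _

lemma locExt_mk₀ {N K : ModuleCat.{u} R} (f : N ⟶ K) :
    locExt S (Ext.mk₀ f) = Ext.mk₀ (ModuleCat.localizedModuleMap S f) :=
  Ext.mapExactFunctor_mk₀ _ _

lemma locExt_comp {N K L : ModuleCat.{u} R} {a b c : ℕ} (x : Ext N K a) (y : Ext K L b)
    (h : a + b = c) : locExt S (x.comp y h) = (locExt S x).comp (locExt S y) h :=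
  Ext.mapExactFunctor_comp _ _ _ _

lemma locExt_extClass {T : ShortComplex (ModuleCat.{u} R)} (hT : T.ShortExact) :
    locExt S hT.extClass =
      (hT.map_of_exact (ModuleCat.localizedModuleFunctor.{u} S)).extClass :=
  Ext.mapExactFunctor_extClass _ _

lemma exists_smul_eq_zero_of_localizedModuleMap {N K : ModuleCat.{u} R} [Module.Finite R N]
    (f : N ⟶ K) (h : ModuleCat.localizedModuleMap S f = 0) : ∃ s ∈ S, s • f = 0 := by
  have key : ∀ x : N, ∃ s ∈ S, s • f.hom x = 0 := by
    intro x
    have h1 := localizedModuleMap_mk S f x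
    rw [h] at h1
    obtain ⟨s, hs⟩ := (IsLocalizedModule.eq_zero_iff S (K.localizedModuleMkLinearMap S)).1 h1.symm
    exact ⟨s, s.2, hs⟩
  choose σ hσ hσ' using key
  obtain ⟨t, ht⟩ := (Module.Finite.fg_top : (⊤ : Submodule R N).FG)
  refine ⟨∏ x ∈ t, σ x, prod_mem fun x _ => hσ x, ?_⟩
  ext x
  change (∏ x ∈ t, σ x) • f.hom x = 0
  have hx : x ∈ Submodule.span R (t : Set N) := ht ▸ trivial
  induction hx using Submodule.span_induction with
  | mem x hx =>
    obtain ⟨c, hc⟩ := Finset.dvd_prod_of_mem σ hx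
    rw [hc, mul_comm, mul_smul, hσ', smul_zero]
  | zero => rw [map_zero, smul_zero]
  | add a b _ _ ha hb => rw [map_add, smul_add, ha, hb, add_zero]
  | smul a b _ hb => rw [map_smul, smul_comm, hb, smul_zero]

lemma exists_localizedModuleMap_eq [IsNoetherianRing R] {N K : ModuleCat.{u} R} [Module.Finite R N]
    (g : N.localizedModule S ⟶ K.localizedModule S) :
    ∃ (f : N ⟶ K) (s : R), s ∈ S ∧
      ModuleCat.localizedModuleMap S f = algebraMap R (Localization S) s • g := by
  have : Module.FinitePresentation R N := Module.finitePresentation_of_finite R N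
  obtain ⟨h, s, hs⟩ := Module.FinitePresentation.exists_lift_of_isLocalizedModule S
    (K.localizedModuleMkLinearMap S) ((g.hom.restrictScalars R) ∘ₗ N.localizedModuleMkLinearMap S)
  refine ⟨ModuleCat.ofHom h, s, s.2, localizedModule_hom_ext S fun x => ?_⟩
  rw [localizedModuleMap_mk]
  refine (LinearMap.congr_fun hs x).trans ?_
  exact (algebraMap_smul (Localization S) (s : R) (g.hom (N.localizedModuleMkLinearMap S x))).symm

theorem locExt_isLocalization [IsNoetherianRing R] (N : ModuleCat.{u} R) [Module.Finite R N]
    (n : ℕ) : ∀ K : ModuleCat.{u} R,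
      (∀ x : Ext N K n, locExt S x = 0 → ∃ s ∈ S, s • x = 0) ∧
      (∀ y : Ext (N.localizedModule S) (K.localizedModule S) n, ∃ (x : Ext N K n) (s : R), s ∈ S ∧
        locExt S x = algebraMap R (Localization S) s • y) := by
  induction n with
  | zero =>
    intro K
    constructor
    · intro x hx
      obtain ⟨f, rfl⟩ := (Ext.mk₀_bijective _ _).2 x
      rw [locExt_mk₀, Ext.mk₀_eq_zero_iff] at hx
      obtain ⟨s, hs, h⟩ := exists_smul_eq_zero_of_localizedModuleMap S f hx
      exact ⟨s, hs, by rw [← Ext.mk₀_smul, h, Ext.mk₀_zero]⟩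
    · intro y
      obtain ⟨g, rfl⟩ := (Ext.mk₀_bijective _ _).2 y
      obtain ⟨f, s, hs, h⟩ := exists_localizedModuleMap_eq S g
      exact ⟨Ext.mk₀ f, s, hs, by rw [locExt_mk₀, h, Ext.mk₀_smul]⟩
  | succ n ih =>
    intro K
    obtain ⟨T, hT, hE, rfl⟩ := exists_injective_shortExact K
    have hL := hT.map_of_exact (ModuleCat.localizedModuleFunctor.{u} S)
    have hE' : Injective (T.map (ModuleCat.localizedModuleFunctor.{u} S)).X₂ :=
      (ModuleCat.localizedModuleFunctor.{u} S).injective_obj T.X₂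
    have hco : ∀ x : Ext N T.X₃ n, locExt S (x.comp hT.extClass rfl) =
        (locExt S x).comp hL.extClass rfl := fun x => by
      rw [locExt_comp, locExt_extClass]
      rfl
    constructor
    · intro x hx
      obtain ⟨x', rfl⟩ := Ext.covariant_sequence_exact₁ N hT x (Ext.eq_zero_of_injective _) rfl
      rw [hco] at hx
      obtain ⟨w, hw⟩ := Ext.covariant_sequence_exact₃ _ hL _ _ hx
      obtain ⟨w', s, hs, hw'⟩ := (ih T.X₂).2 w
      have h0 : locExt S (s • x' - w'.comp (Ext.mk₀ T.g) (add_zero n)) = 0 := by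
        rw [sub_eq_add_neg, ← neg_one_smul R (w'.comp (Ext.mk₀ T.g) (add_zero n)), locExt_add,
          locExt_smul, locExt_smul, locExt_comp, locExt_mk₀, hw']
        rw [map_neg, map_one, neg_one_smul, ← sub_eq_add_neg, sub_eq_zero, ← hw]
        exact (Ext.smul_comp _ _ _ _).symm
      obtain ⟨t, ht, h1⟩ := (ih T.X₃).1 _ h0
      refine ⟨t * s, mul_mem ht hs, ?_⟩
      rw [smul_sub, sub_eq_zero] at h1
      rw [← Ext.smul_comp, mul_smul, h1, Ext.smul_comp, Ext.comp_assoc_of_second_deg_zero,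
        hT.comp_extClass, Ext.comp_zero, smul_zero]
    · intro y
      obtain ⟨y', rfl⟩ := Ext.covariant_sequence_exact₁ _ hL y (Ext.eq_zero_of_injective _) rfl
      obtain ⟨x', s, hs, h⟩ := (ih T.X₃).2 y'
      refine ⟨x'.comp hT.extClass rfl, s, hs, ?_⟩
      rw [hco, h]
      exact Ext.smul_comp _ _ _ _

theorem subsingleton_ext_localizedModule_iff [IsNoetherianRing R] (N K : ModuleCat.{u} R)
    [Module.Finite R N] (n : ℕ) :
    Subsingleton (Ext (N.localizedModule S) (K.localizedModule S) n) ↔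
      ∀ x : Ext N K n, ∃ s ∈ S, s • x = 0 := by
  constructor
  · intro h x
    exact (locExt_isLocalization S N n K).1 x (Subsingleton.elim _ _)
  · intro h
    refine subsingleton_of_forall_eq 0 fun y => ?_
    obtain ⟨x, s, hs, hx⟩ := (locExt_isLocalization S N n K).2 y
    obtain ⟨t, ht, h0⟩ := h x
    have h1 := congrArg (locExt S) h0
    have hz : locExt S (0 : Ext N K n) = 0 := Ext.mapExactFunctor_zero _ _ _ _
    rw [locExt_smul, hx, hz] at h1
    have hu : ∀ s ∈ S, IsUnit (algebraMap R (Localization S) s) := fun s hs =>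
      IsLocalization.map_units _ (⟨s, hs⟩ : S)
    exact (hu s hs).smul_eq_zero.1 ((hu t ht).smul_eq_zero.1 h1)

end LocExt

namespace LocalDuality
open Abelian IsLocalRing

variable {A : Type u} [CommRing A] [IsLocalRing A]

/-- `RegQuot l M Q`: the module `Q` arises from `M` by dividing out successively `l`
elements of the maximal ideal, each regular on the module it is applied to. -/
inductive RegQuot : ℕ → ModuleCat.{u} A → ModuleCat.{u} A → Prop
  | refl (M : ModuleCat.{u} A) : RegQuot 0 M M
  | step {l : ℕ} {M Q : ModuleCat.{u} A} (x : A) (hx : x ∈ maximalIdeal A)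
      (reg : IsSMulRegular M x) (h : RegQuot l (ModuleCat.of A (QuotSMulTop x M)) Q) :
      RegQuot (l + 1) M Q

/-- A module whose Ext groups into all sufficiently high degrees vanish. -/
def FiniteInjDim {R : Type u} [CommRing R] (C : ModuleCat.{u} R) : Prop :=
  ∃ n₀ : ℕ, ∀ (N : ModuleCat.{u} R) (i : ℕ), n₀ < i → Subsingleton (Ext N C i)

/-- The residue field as an object of the module category. -/
abbrev resField (A : Type u) [CommRing A] [IsLocalRing A] : ModuleCat.{u} A :=
  ModuleCat.of A (A ⧸ maximalIdeal A)

lemma smul_comp_id {R : Type u} [CommRing R] {M C : ModuleCat.{u} R} {i : ℕ} (r : R)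
    (x : Ext M C i) : (Ext.mk₀ (r • 𝟙 M)).comp x (zero_add i) = r • x := by
  rw [Ext.mk₀_smul, Ext.smul_comp, Ext.mk₀_id_comp]

lemma subsingleton_of_smul_surjective {E : Type*} [AddCommGroup E] [Module A E]
    [Module.Finite A E] {x : A} (hx : x ∈ maximalIdeal A) (h : ∀ e : E, ∃ e', x • e' = e) :
    Subsingleton E := by
  have := Submodule.eq_bot_of_le_smul_of_le_jacobson_bot (maximalIdeal A) (⊤ : Submodule A E)
    Module.Finite.fg_top (fun e _ => by
      obtain ⟨e', rfl⟩ := h e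
      exact Submodule.smul_mem_smul hx trivial) (maximalIdeal_le_jacobson _)
  exact (Submodule.subsingleton_iff A).1 (subsingleton_of_bot_eq_top this.symm)

lemma subsingleton_ext_quotSMulTop {R : Type u} [CommRing R] (M C : ModuleCat.{u} R)
    {x : R} (reg : IsSMulRegular M x) (i : ℕ) (h0 : Subsingleton (Ext M C i)) (h1 : Subsingleton (Ext M C (i + 1))) :
    Subsingleton (Ext (ModuleCat.of R (QuotSMulTop x M)) C (i + 1)) := by
  refine subsingleton_of_forall_eq 0 fun e => ?_
  obtain ⟨e', he⟩ := Ext.contravariant_sequence_exact₃ reg.smulShortComplex_shortExact C e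
    (@Subsingleton.elim _ h1 _ _) (add_comm 1 i)
  refine he.symm.trans ((congrArg (fun z => Ext.comp _ z (add_comm 1 i))
    (@Subsingleton.elim _ h0 e' 0)).trans ?_)
  exact Ext.comp_zero _ _ _ _ _

lemma RegQuot.finite {l : ℕ} {M Q : ModuleCat.{u} A} (h : RegQuot l M Q)
    (hM : Module.Finite A M) : Module.Finite A Q := by
  revert hM
  induction h with
  | refl => exact id
  | step x hx reg h ih => exact fun hM => ih (Module.Finite.quotient A _)

lemma RegQuot.subsingleton_ext_target {l : ℕ} {M Q : ModuleCat.{u} A} (h : RegQuot l M Q)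
    (C : ModuleCat.{u} A) (j₀ : ℕ)
    (hE : ∀ j, j₀ < j → Subsingleton (Ext M C j)) (j : ℕ) (hj : j₀ + l < j) :
    Subsingleton (Ext Q C j) := by
  induction h generalizing j₀ with
  | refl => exact hE j hj
  | @step l M Q x hx reg h ih =>
    refine ih (j₀ + 1) (fun j hj => ?_) (by lia)
    obtain ⟨i, rfl⟩ : ∃ i, j = i + 1 := ⟨j - 1, by lia⟩
    exact subsingleton_ext_quotSMulTop M C reg i (hE i (by lia)) (hE (i + 1) (by lia))

variable [IsNoetherianRing A]

lemma subsingleton_ext_of_quotSMulTop (M C : ModuleCat.{u} A) [Module.Finite A M]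
    [Module.Finite A C] {x : A} (hx : x ∈ maximalIdeal A) (reg : IsSMulRegular M x) (i : ℕ)
    (h : Subsingleton (Ext (ModuleCat.of A (QuotSMulTop x M)) C (i + 1))) :
    Subsingleton (Ext M C i) := by
  refine subsingleton_of_smul_surjective hx fun e => ?_
  obtain ⟨e', he⟩ := Ext.contravariant_sequence_exact₁ reg.smulShortComplex_shortExact C e
    (add_comm 1 i) (@Subsingleton.elim _ h _ _)
  exact ⟨e', (smul_comp_id x e').symm.trans he⟩

namespace RegQuot

lemma supportDim {l : ℕ} {M Q : ModuleCat.{u} A} (h : RegQuot l M Q)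
    (hM : Module.Finite A M) : Module.supportDim A Q + l = Module.supportDim A M := by
  revert hM
  induction h with
  | refl => simp
  | step x hx reg h ih =>
    intro hM
    rw [← Module.supportDim_quotSMulTop_succ_eq_supportDim reg hx,
      ← ih (Module.Finite.quotient A _)]
    push_cast
    rw [add_assoc]

lemma subsingleton_ext_source {l : ℕ} {M Q : ModuleCat.{u} A} (h : RegQuot l M Q)
    (hM : Module.Finite A M) (C : ModuleCat.{u} A) [Module.Finite A C] (i : ℕ)
    (hE : Subsingleton (Ext Q C (i + l))) : Subsingleton (Ext M C i) := by
  revert hM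
  induction h generalizing i with
  | refl => exact fun _ => hE
  | @step l M Q x hx reg h ih =>
    intro hM
    refine subsingleton_ext_of_quotSMulTop M C hx reg i
      (ih (i + 1) ?_ (Module.Finite.quotient A _))
    rwa [add_assoc, add_comm 1 l]

end RegQuot

lemma subsingleton_ext_congr {R : Type u} [CommRing R] {M M' : ModuleCat.{u} R} (e : M ≅ M')
    (C : ModuleCat.{u} R) (i : ℕ) (h : Subsingleton (Ext M C i)) :
    Subsingleton (Ext M' C i) := by
  refine subsingleton_of_forall_eq 0 fun x => ?_
  have h1 : (Ext.mk₀ e.inv).comp ((Ext.mk₀ e.hom).comp x (zero_add i)) (zero_add i) = x := by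
    rw [Ext.mk₀_comp_mk₀_assoc, e.inv_hom_id, Ext.mk₀_id_comp]
  rw [← h1, Subsingleton.elim ((Ext.mk₀ e.hom).comp x (zero_add i)) 0, Ext.comp_zero]

lemma subsingleton_ext_middle {R : Type u} [CommRing R] {S : ShortComplex (ModuleCat.{u} R)}
    (hS : S.ShortExact) (C : ModuleCat.{u} R) (i : ℕ) (h1 : Subsingleton (Ext S.X₁ C i))
    (h3 : Subsingleton (Ext S.X₃ C i)) : Subsingleton (Ext S.X₂ C i) := by
  refine subsingleton_of_forall_eq 0 fun x => ?_
  obtain ⟨y, hy⟩ := Ext.contravariant_sequence_exact₂ hS C x (Subsingleton.elim _ _)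
  rw [← hy, Subsingleton.elim y 0, Ext.comp_zero]

lemma subsingleton_ext_of_resField (C : ModuleCat.{u} A) [Module.Finite A C] (i : ℕ)
    (h : ∀ N : ModuleCat.{u} A, Module.Finite A N → Subsingleton (Ext N C (i + 1)))
    (hk : Subsingleton (Ext (resField A) C i)) (N : ModuleCat.{u} A) (hN : Module.Finite A N) :
    Subsingleton (Ext N C i) := by
  refine IsNoetherianRing.induction_on_isQuotientEquivQuotientPrime A hN
    (motive := fun N _ _ _ => Subsingleton (Ext (ModuleCat.of A N) C i)) ?_ ?_ ?_
  · intro N _ _ _ _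
    refine subsingleton_of_forall_eq 0 fun x => ?_
    rw [← Ext.mk₀_id_comp x, (ModuleCat.isZero_of_subsingleton (ModuleCat.of A N)).eq_of_src
      (𝟙 _) 0, Ext.mk₀_zero, Ext.zero_comp]
  · intro N _ _ _ p e
    refine subsingleton_ext_congr (LinearEquiv.toModuleIso e.symm) C i ?_
    by_cases hp : p.asIdeal = maximalIdeal A
    · rw [hp]; exact hk
    · obtain ⟨x, hxm, hxp⟩ : ∃ x ∈ maximalIdeal A, x ∉ p.asIdeal := by
        by_contra! hcon
        exact hp (le_antisymm (le_maximalIdeal p.2.ne_top) hcon)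
      have reg : IsSMulRegular (A ⧸ p.asIdeal) x := by
        rw [isSMulRegular_iff_right_eq_zero_of_smul]
        intro y hy
        obtain ⟨y, rfl⟩ := Ideal.Quotient.mk_surjective y
        have : x * y ∈ p.asIdeal := Ideal.Quotient.eq_zero_iff_mem.1 hy
        exact Ideal.Quotient.eq_zero_iff_mem.2 ((p.2.mem_or_mem this).resolve_left hxp)
      exact subsingleton_ext_of_quotSMulTop (ModuleCat.of A (A ⧸ p.asIdeal)) C hxm reg i
        (h _ (inferInstanceAs (Module.Finite A (QuotSMulTop x (A ⧸ p.asIdeal)))))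
  · intro N₁ _ _ _ N₂ _ _ _ N₃ _ _ _ f g hf hg hfg h1 h3
    exact subsingleton_ext_middle (ModuleCat.shortComplex_shortExact
      (ModuleCat.shortComplexOfCompEqZero f g hfg.linearMap_comp_eq_zero) hfg hf hg) C i h1 h3

end LocalDuality

namespace LocalDuality
open Abelian IsLocalRing

variable {A : Type u} [CommRing A] [IsLocalRing A] [IsNoetherianRing A]

lemma exists_mono_resField (Q : ModuleCat.{u} A) (h : Module.supportDim A Q = 0) :
    ∃ f : resField A ⟶ Q, Mono f := by
  have hnt : Nontrivial Q := by
    by_contra hn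
    rw [not_nontrivial_iff_subsingleton, ← Module.supportDim_eq_bot_iff_subsingleton A, h] at hn
    exact absurd hn (by simp)
  obtain ⟨P, hP⟩ := associatedPrimes.nonempty A Q
  obtain ⟨hprime, x, hx⟩ := isAssociatedPrime_iff.1 hP
  have hPm : P = maximalIdeal A := by
    have hmem (P' : PrimeSpectrum A) (hle : P ≤ P'.asIdeal) : P' ∈ Module.support A Q := by
      rw [Module.mem_support_iff']
      refine ⟨x, fun r hr h0 => hr (hle ?_)⟩
      rw [hx, Submodule.mem_colon_singleton]
      exact h0
    have hmin := Order.krullDim_nonpos_iff_forall_isMin.1 h.le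
      ⟨closedPoint A, hmem _ (le_maximalIdeal hprime.ne_top)⟩
    refine le_antisymm (le_maximalIdeal hprime.ne_top) ?_
    exact hmin (b := ⟨⟨P, hprime⟩, hmem _ le_rfl⟩) (le_maximalIdeal hprime.ne_top)
  subst hPm
  obtain ⟨-, f, hf⟩ := (isAssociatedPrime_iff_exists_injective_linearMap _ _).1 hP
  exact ⟨ModuleCat.ofHom f, (ModuleCat.mono_iff_injective _).2 hf⟩

/-- Mono maps induce surjections on Ext when the next Ext of the cokernel vanishes. -/
lemma exists_comp_eq_of_mono {R : Type u} [CommRing R] {M N C : ModuleCat.{u} R} (f : M ⟶ N)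
    [Mono f] (i : ℕ) (h : Subsingleton (Ext (Limits.cokernel f) C (i + 1))) (x : Ext M C i) :
    ∃ y : Ext N C i, (Ext.mk₀ f).comp y (zero_add i) = x := by
  have hS : (ShortComplex.mk f (Limits.cokernel.π f) (by simp)).ShortExact :=
    { exact := ShortComplex.exact_cokernel f }
  exact Ext.contravariant_sequence_exact₁ hS C x (add_comm 1 i) (@Subsingleton.elim _ h _ _)

lemma finite_cokernel {R : Type u} [CommRing R] {M N : ModuleCat.{u} R} (f : M ⟶ N)
    [hN : Module.Finite R N] : Module.Finite R (Limits.cokernel f : ModuleCat.{u} R) :=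
  Module.Finite.of_surjective (Limits.cokernel.π f).hom
    ((ModuleCat.epi_iff_surjective _).1 inferInstance)

section CM

variable {d : ℕ} {Q : ModuleCat.{u} A} (hQ : RegQuot d (ModuleCat.of A A) Q)
  (hd : ringKrullDim A = d) (C : ModuleCat.{u} A) [Module.Finite A C] (hC : FiniteInjDim C)
include hQ hd hC

lemma subsingleton_ext_of_gt_dim (i : ℕ) (hi : d < i) (N : ModuleCat.{u} A)
    (hN : Module.Finite A N) : Subsingleton (Ext N C i) := by
  have hfin : Module.Finite A Q := hQ.finite (inferInstanceAs (Module.Finite A A))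
  have hQ0 : Module.supportDim A Q = 0 := by
    have h1 := hQ.supportDim (inferInstanceAs (Module.Finite A A))
    have h2 : Module.supportDim A (ModuleCat.of A A) = 0 + (d : WithBot ℕ∞) := by
      rw [zero_add, ← hd]; exact Module.supportDim_self_eq_ringKrullDim A
    rw [h2] at h1
    exact ENat.WithBot.add_natCast_cancel.1 h1
  obtain ⟨f, hf⟩ := exists_mono_resField Q hQ0
  obtain ⟨n₀, hn₀⟩ := hC
  suffices H : ∀ j i, d < i → n₀ < i + j → ∀ N : ModuleCat.{u} A, Module.Finite A N →
      Subsingleton (Ext N C i) from H (n₀ + 1) i hi (by lia) N hN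
  intro j
  induction j with
  | zero => exact fun i _ h N _ => hn₀ N i h
  | succ j ih =>
    intro i hi hij N hN
    have hnext := ih (i + 1) (by lia) (by lia)
    refine subsingleton_ext_of_resField C i hnext ?_ N hN
    refine subsingleton_of_forall_eq 0 fun x => ?_
    obtain ⟨y, rfl⟩ := exists_comp_eq_of_mono f i (hnext _ (finite_cokernel f)) x
    have := hQ.subsingleton_ext_target C 0 (fun j hj => by
      obtain ⟨j, rfl⟩ : ∃ j', j = j' + 1 := ⟨j - 1, by lia⟩
      have : Projective (ModuleCat.of A A) := inferInstance
      exact subsingleton_of_forall_eq 0 fun e => Ext.eq_zero_of_projective e) i (by lia)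
    rw [Subsingleton.elim y 0, Ext.comp_zero]

lemma subsingleton_ext_of_regQuot {l : ℕ} {N Q' : ModuleCat.{u} A} (hN : Module.Finite A N)
    (h : RegQuot l N Q') (i : ℕ) (hi : d < i + l) : Subsingleton (Ext N C i) :=
  h.subsingleton_ext_source hN C i (subsingleton_ext_of_gt_dim hQ hd C hC _ hi _ (h.finite hN))

lemma exists_ext_resField_ne_zero [Nontrivial C] : ∃ x : Ext (resField A) C d, x ≠ 0 := by
  by_contra! hx
  have hQd := subsingleton_ext_of_resField C d
    (subsingleton_ext_of_gt_dim hQ hd C hC (d + 1) (by lia)) (subsingleton_of_forall_eq 0 hx) Q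
    (hQ.finite (inferInstanceAs (Module.Finite A A)))
  have h0 := hQ.subsingleton_ext_source (inferInstanceAs (Module.Finite A A)) C 0
    (by rwa [zero_add])
  have e : Ext (ModuleCat.of A A) C 0 ≃ C :=
    (Ext.linearEquiv₀ (R := A)).toEquiv.trans (ModuleCat.homLinearEquiv (S := A).toEquiv.trans
      (LinearMap.ringLmapEquivSelf A A C).toEquiv)
  exact not_subsingleton C e.symm.subsingleton

/-- Nonzero classes in the socle cohomology of `D` are detected by pairing with maps into `C`. -/
lemma exists_comp_ne_zero [Nontrivial C] {l : ℕ} {D Q' : ModuleCat.{u} A}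
    (h : RegQuot l D Q') (hD : Module.Finite A D) (a : Ext (resField A) D l) (ha : a ≠ 0)
    (m : ℕ) (hm : l + m = d) : ∃ f : Ext D C m, a.comp f hm ≠ 0 := by
  revert hD
  induction h generalizing m with
  | refl D =>
    intro hD
    obtain rfl : m = d := by lia
    obtain ⟨φ, rfl⟩ := (Ext.mk₀_bijective _ _).2 a
    have hsimple : Simple (resField A) :=
      simple_iff_isSimpleModule.2 (isSimpleModule_iff_quot_maximal.2
        ⟨maximalIdeal A, inferInstance, ⟨LinearEquiv.refl A _⟩⟩)
    have : Mono φ := mono_of_nonzero_from_simple fun h => ha (by rw [h, Ext.mk₀_zero])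
    obtain ⟨b, hb⟩ := exists_ext_resField_ne_zero hQ hd C hC
    obtain ⟨f, hf⟩ := exists_comp_eq_of_mono φ m
      (subsingleton_ext_of_gt_dim hQ hd C hC _ (by lia) _ (finite_cokernel φ)) b
    exact ⟨f, hf ▸ hb⟩
  | @step l D Q' x hx reg h ih =>
    intro hD
    have hS := reg.smulShortComplex_shortExact
    obtain ⟨a₁, ha₁⟩ := Ext.covariant_sequence_exact₁ (resField A) hS a (by
      have h0 : x • 𝟙 (resField A) = 0 := by
        refine ModuleCat.hom_ext (LinearMap.ext fun y => ?_)
        obtain ⟨y, rfl⟩ := Ideal.Quotient.mk_surjective y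
        exact Ideal.Quotient.eq_zero_iff_mem.2 (Ideal.mul_mem_right y _ hx)
      have h1 : a.comp (Ext.mk₀ (x • 𝟙 D)) (add_zero _) = 0 := by
        rw [Ext.mk₀_smul, Ext.comp_smul, Ext.comp_mk₀_id, ← smul_comp_id, h0, Ext.mk₀_zero,
          Ext.zero_comp]
      exact h1) rfl
    obtain ⟨f₁, hf₁⟩ := ih a₁ (by
      rintro rfl
      exact ha (ha₁.symm.trans (Ext.zero_comp _ _ _ _ _))) (m + 1) (by lia)
      (Module.Finite.quotient A _)
    obtain ⟨f, hf⟩ := Ext.contravariant_sequence_exact₃ hS C f₁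
      (@Subsingleton.elim _ (subsingleton_ext_of_regQuot hQ hd C hC hD (.step x hx reg h)
        (m + 1) (by lia)) _ _) (add_comm 1 m)
    refine ⟨f, fun h0 => hf₁ ?_⟩
    rw [← hf, ← h0]
    refine ((Ext.comp_assoc a₁ hS.extClass f rfl (add_comm 1 m) (by lia)).symm).trans ?_
    exact congrArg (fun z => Ext.comp z f hm) ha₁

end CM
end LocalDuality

namespace LocalDuality
open Abelian IsLocalRing

variable {A : Type u} [CommRing A] [IsLocalRing A]

lemma exists_regQuot_of_isWeaklyRegular (rs : List A) (hrs : ∀ r ∈ rs, r ∈ maximalIdeal A)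
    (M : ModuleCat.{u} A) (h : RingTheory.Sequence.IsWeaklyRegular M rs) :
    ∃ Q, RegQuot rs.length M Q := by
  induction rs generalizing M with
  | nil => exact ⟨M, .refl M⟩
  | cons r rs ih =>
    rw [RingTheory.Sequence.isWeaklyRegular_cons_iff] at h
    obtain ⟨Q, hQ⟩ := ih (fun s hs => hrs s (List.mem_cons_of_mem r hs))
      (ModuleCat.of A (QuotSMulTop r M)) h.2
    exact ⟨Q, .step r (hrs r List.mem_cons_self) h.1 hQ⟩

lemma subsingleton_ext_quot_of_covariant {R : Type u} [CommRing R] (N M : ModuleCat.{u} R) {x : R}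
    (reg : IsSMulRegular M x) (i : ℕ) (h0 : Subsingleton (Ext N M i))
    (h1 : Subsingleton (Ext N M (i + 1))) :
    Subsingleton (Ext N (ModuleCat.of R (QuotSMulTop x M)) i) := by
  refine subsingleton_of_forall_eq 0 fun e => ?_
  obtain ⟨e', he⟩ := Ext.covariant_sequence_exact₃ N reg.smulShortComplex_shortExact e rfl
    (@Subsingleton.elim _ h1 _ _)
  refine he.symm.trans ((congrArg (fun z => Ext.comp z _ (add_zero i))
    (@Subsingleton.elim _ h0 e' 0)).trans ?_)
  exact Ext.zero_comp _ _ _ _ _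

lemma RegQuot.subsingleton_ext_of_nilpotent {l : ℕ} {D Q : ModuleCat.{u} A} (h : RegQuot l D Q)
    (N : ModuleCat.{u} A) (hN : ∀ x ∈ maximalIdeal A, ∃ j : ℕ, ∀ n : N, x ^ j • n = 0)
    (i : ℕ) (hi : i < l) : Subsingleton (Ext N D i) := by
  induction h generalizing i with
  | refl => lia
  | @step l D Q x hx reg h ih =>
    have hinj (e : Ext N D i) (he : x • e = 0) : e = 0 := by
      have h1 : e.comp (Ext.mk₀ (x • 𝟙 D)) (add_zero _) = 0 := by
        rw [Ext.mk₀_smul, Ext.comp_smul, Ext.comp_mk₀_id, he]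
      cases i with
      | zero =>
        obtain ⟨φ, rfl⟩ := (Ext.mk₀_bijective _ _).2 e
        rw [Ext.mk₀_comp_mk₀, Ext.mk₀_eq_zero_iff] at h1
        have hmono : Mono (x • 𝟙 D) := reg.smulShortComplex_shortExact.mono_f
        rw [(cancel_mono (x • 𝟙 D)).1 (h1.trans Limits.zero_comp.symm), Ext.mk₀_zero]
      | succ i =>
        obtain ⟨e', he'⟩ := Ext.covariant_sequence_exact₁ N reg.smulShortComplex_shortExact e h1
          rfl
        refine he'.symm.trans ((congrArg (fun z => Ext.comp z _ rfl)
          (@Subsingleton.elim _ (ih i (by lia)) e' 0)).trans ?_)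
        exact Ext.zero_comp _ _ _ _ _
    obtain ⟨j, hj⟩ := hN x hx
    refine subsingleton_of_forall_eq 0 fun e => ?_
    have hpow (k : ℕ) (e : Ext N D i) (he : x ^ k • e = 0) : e = 0 := by
      induction k with
      | zero => simpa using! he
      | succ k ihk => exact ihk (hinj _ (by rw [smul_smul, ← pow_succ', he]))
    refine hpow j e ?_
    have h0 : x ^ j • 𝟙 N = 0 := ModuleCat.hom_ext (LinearMap.ext fun n => hj n)
    rw [← smul_comp_id, h0, Ext.mk₀_zero, Ext.zero_comp]

lemma exists_quotient_addEquiv {R M M' : Type*} [CommRing R] [AddCommGroup M] [AddCommGroup M']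
    [Module R M] [Module R M'] (p : Submodule R M) (p' : Submodule R M') (σ : M' ≃+ M)
    (h : ∀ m, m ∈ p' ↔ σ m ∈ p) :
    ∃ τ : (M' ⧸ p') ≃+ (M ⧸ p), ∀ m, τ (p'.mkQ m) = p.mkQ (σ m) := by
  let φ : M' →+ M ⧸ p := (p.mkQ : M →+ M ⧸ p).comp σ.toAddMonoidHom
  have hφ : ∀ m, φ m = 0 ↔ m ∈ p' := fun m => (Submodule.Quotient.mk_eq_zero p).trans (h m).symm
  let τ : M' ⧸ p' →+ M ⧸ p := QuotientAddGroup.lift p'.toAddSubgroup φ fun m hm => (hφ m).2 hm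
  refine ⟨AddEquiv.ofBijective τ ⟨(injective_iff_map_eq_zero τ).2 fun m hm => ?_, fun m => ?_⟩,
    fun m => rfl⟩
  · obtain ⟨m, rfl⟩ := p'.mkQ_surjective m
    exact (Submodule.Quotient.mk_eq_zero p').2 ((hφ m).1 hm)
  · obtain ⟨m, rfl⟩ := p.mkQ_surjective m
    exact ⟨p'.mkQ (σ.symm m), congrArg p.mkQ (σ.apply_symm_apply m)⟩

variable [IsNoetherianRing A]

open Pointwise in
/-- A depth bound transfers along Frobenius-semilinear equivalences. -/
lemma exists_regQuot_of_semilinear (q l : ℕ) (N M M' : ModuleCat.{u} A) [Module.Finite A N]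
    [Nontrivial N] (hfin : Module.Finite A M) (hM : ∀ i < l, Subsingleton (Ext N M i))
    (σ : M' ≃+ M) (hσ : ∀ (a : A) m, σ (a • m) = a ^ q • σ m) : ∃ Q, RegQuot l M' Q := by
  induction l generalizing M M' with
  | zero => exact ⟨M', .refl M'⟩
  | succ l ih =>
    have h0 : Subsingleton (N →ₗ[A] M) := by
      have := hM 0 (by lia)
      exact ((Ext.linearEquiv₀ (R := A) (X := N) (Y := M)).toEquiv.trans
        (ModuleCat.homLinearEquiv (S := A)).toEquiv).symm.subsingleton
    obtain ⟨x, hx, reg⟩ := IsSMulRegular.subsingleton_linearMap_iff.1 h0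
    replace hx : x ∈ maximalIdeal A := le_maximalIdeal
      (fun h => not_subsingleton N (Module.annihilator_eq_top_iff.1 h)) hx
    have reg' : IsSMulRegular M' x := fun a b hab => σ.injective (reg.pow q (by
      change x ^ q • σ a = x ^ q • σ b
      rw [← hσ, ← hσ]
      exact congrArg σ hab))
    obtain ⟨τ, hτ⟩ := exists_quotient_addEquiv (x ^ q • (⊤ : Submodule A M))
      (x • (⊤ : Submodule A M')) σ (fun m => by
        constructor
        · rintro ⟨m, -, rfl⟩
          exact ⟨σ m, trivial, (hσ x m).symm⟩
        · rintro ⟨m', -, h⟩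
          refine ⟨σ.symm m', trivial, σ.injective ((hσ x _).trans ?_)⟩
          rw [σ.apply_symm_apply]
          exact h)
    obtain ⟨Q, hQ⟩ := ih (ModuleCat.of A (QuotSMulTop (x ^ q) M))
      (ModuleCat.of A (QuotSMulTop x M')) (Module.Finite.quotient A _)
      (fun i hi => subsingleton_ext_quot_of_covariant _ M (reg.pow q) i (hM i (by lia))
        (hM (i + 1) (by lia))) τ (fun a m => by
          obtain ⟨m, rfl⟩ := (x • (⊤ : Submodule A M')).mkQ_surjective m
          refine (hτ (a • m)).trans ?_
          rw [hσ]
          exact congrArg (a ^ q • ·) (hτ m).symm)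
    exact ⟨Q, .step x hx reg' hQ⟩

lemma exists_regQuot_of_subsingleton_ext (l : ℕ) (N M : ModuleCat.{u} A)
    [Module.Finite A N] [Nontrivial N] (hfin : Module.Finite A M)
    (hM : ∀ i < l, Subsingleton (Ext N M i)) :
    ∃ Q, RegQuot l M Q :=
  exists_regQuot_of_semilinear 1 l N M M hfin hM (AddEquiv.refl M) fun a m => by simp

end LocalDuality

namespace LocalDuality
open Abelian IsLocalRing
open scoped Pointwise

variable {A : Type u} [CommRing A]

/-- Dividing by a regular element commutes with `Hom(C, -)` if `Ext¹(C, -)` vanishes. -/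
lemma nonempty_quotSMulTop_hom_equiv (C D : ModuleCat.{u} A) {H : Type u} [AddCommGroup H]
    [Module A H] (e : H ≃ₗ[A] (C →ₗ[A] D)) {x : A} (reg : IsSMulRegular D x)
    (h1 : Subsingleton (Ext C D 1)) :
    Nonempty (QuotSMulTop x H ≃ₗ[A] (C →ₗ[A] QuotSMulTop x D)) := by
  have hS := ExtTools.homShort_shortExact C reg.smulShortComplex_shortExact h1
  have hex := (ShortComplex.ShortExact.moduleCat_exact_iff_function_exact _).1 hS.exact
  have hsurj := (ModuleCat.epi_iff_surjective _).1 hS.epi_g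
  let Θ : H →ₗ[A] (C →ₗ[A] QuotSMulTop x D) :=
    (LinearMap.compRight A (x • (⊤ : Submodule A D)).mkQ).comp e.toLinearMap
  have hΘ : Function.Surjective Θ := fun y => by
    obtain ⟨z, hz⟩ := hsurj y
    exact ⟨e.symm z, (congrArg _ (e.apply_symm_apply z)).trans hz⟩
  refine ⟨(Submodule.quotEquivOfEq _ _ ?_).trans (Θ.quotKerEquivOfSurjective hΘ)⟩
  ext h
  constructor
  · rintro ⟨h, -, rfl⟩
    change Θ (x • h) = 0
    ext c
    refine (Submodule.Quotient.mk_eq_zero (x • (⊤ : Submodule A D))).2 ⟨e h c, trivial, ?_⟩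
    rw [map_smul]
    rfl
  · intro hh
    obtain ⟨z, hz⟩ := (hex (e h)).1 hh
    refine ⟨e.symm z, trivial, e.injective ?_⟩
    exact (map_smul e x _).trans ((congrArg (x • ·) (e.apply_symm_apply z)).trans hz)

variable [IsNoetherianRing A]

lemma isSMulRegular_of_hom (C D : ModuleCat.{u} A) [Module.Finite A C] [Module.Finite A D]
    (hC : Module.annihilator A C = ⊥) {x : A} (reg : IsSMulRegular (C →ₗ[A] D) x) :
    IsSMulRegular D x := by
  let T := LinearMap.ker (LinearMap.lsmul A D x)
  have h0 : Subsingleton (C →ₗ[A] T) := subsingleton_of_forall_eq 0 fun φ => by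
    have : T.subtype.comp φ = 0 := reg.right_eq_zero_of_smul <| by
      ext c
      exact (φ c).2
    ext c
    exact LinearMap.congr_fun this c
  obtain ⟨r, hr, hreg⟩ := IsSMulRegular.subsingleton_linearMap_iff.1 h0
  rw [hC, Submodule.mem_bot] at hr
  subst hr
  rw [isSMulRegular_iff_right_eq_zero_of_smul]
  intro y hy
  exact congrArg Subtype.val (hreg (a₁ := (⟨y, hy⟩ : T)) (a₂ := 0) (by simp))

variable [IsLocalRing A]

/-- The depth of `Hom(C, D)` bounds the depth of `D` from below. -/
lemma exists_regQuot_of_hom (C : ModuleCat.{u} A) [Module.Finite A C]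
    (hC : Module.annihilator A C = ⊥) {l : ℕ} {H Q : ModuleCat.{u} A} (h : RegQuot l H Q)
    (D : ModuleCat.{u} A) (hD : Module.Finite A D)
    (hE : ∀ i, Subsingleton (Ext C D (i + 1))) (e : H ≃ₗ[A] (C →ₗ[A] D)) :
    ∃ Q', RegQuot l D Q' := by
  induction h generalizing D with
  | refl => exact ⟨D, .refl D⟩
  | @step l H Q x hx reg h ih =>
    have regD := isSMulRegular_of_hom C D hC ((e.isSMulRegular_congr x).1 reg)
    obtain ⟨e'⟩ := nonempty_quotSMulTop_hom_equiv C D e regD (hE 0)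
    obtain ⟨Q', hQ'⟩ := ih (ModuleCat.of A (QuotSMulTop x D)) (Module.Finite.quotient A _)
      (fun i => subsingleton_ext_quot_of_covariant C D regD _ (hE i) (hE (i + 1))) e'
    exact ⟨Q', .step x hx regD hQ'⟩

end LocalDuality

namespace LocalDuality
open Abelian IsLocalRing LocExt

/-- The defining properties of a canonical module, in terms of `Abelian.Ext`. -/
structure Canonical {R : Type u} [CommRing R] (ω : ModuleCat.{u} R) : Prop where
  finite : Module.Finite R ω
  finiteInjDim : FiniteInjDim ω
  bijective : Function.Bijective (algebraMap R (Module.End R ω))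
  subsingleton_ext : ∀ i, Subsingleton (Ext ω ω (i + 1))

lemma _root_.IsCanonicalModule.canonical {R : Type u} [CommRing R] {ω : Type u} [AddCommGroup ω]
    [Module R ω] (h : IsCanonicalModule R ω) : Canonical (ModuleCat.of R ω) where
  finite := h.1
  finiteInjDim := by
    obtain ⟨n, hn⟩ := h.2.1
    exact ⟨n, fun N i hi => have := hn N i hi; (ExtBridge.extEquiv i N _).symm.subsingleton⟩
  bijective := h.2.2.1
  subsingleton_ext i := by
    have := h.2.2.2 (i + 1) (by lia)
    exact (ExtBridge.extEquiv (i + 1) _ _).symm.subsingleton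

section Localize

variable {R : Type u} [CommRing R] (S : Submonoid R)

lemma finite_localizedModule (N : ModuleCat.{u} R) [Module.Finite R N] :
    Module.Finite (Localization S) (N.localizedModule S) :=
  Module.Finite.of_isLocalizedModule S (Rₚ := Localization S) (N.localizedModuleMkLinearMap S)

lemma FiniteInjDim.localizedModule [IsNoetherianRing R] {C : ModuleCat.{u} R}
    (hC : FiniteInjDim C) : FiniteInjDim (C.localizedModule S) := by
  obtain ⟨n, hn⟩ := hC
  have : HasInjectiveDimensionLE C n :=
    (hasInjectiveDimensionLT_iff C (n + 1)).2 fun i hi Y e =>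
      @Subsingleton.elim _ (hn Y i (by lia)) _ _
  have h := C.localizedModule_hasInjectiveDimensionLE n S
  refine ⟨n, fun N i hi => subsingleton_of_forall_eq 0 fun e => ?_⟩
  exact (hasInjectiveDimensionLT_iff _ (n + 1)).1 h i (by lia) e

lemma Canonical.localizedModule [IsNoetherianRing R] {ω : ModuleCat.{u} R} (hω : Canonical ω) :
    Canonical (ω.localizedModule S) := by
  have := hω.finite
  refine ⟨finite_localizedModule S ω, hω.finiteInjDim.localizedModule S, ⟨?_, ?_⟩, fun i => ?_⟩
  · rw [injective_iff_map_eq_zero]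
    intro a ha
    obtain ⟨r, s, rfl⟩ := IsLocalization.exists_mk'_eq S a
    have h0 : ModuleCat.localizedModuleMap S (r • 𝟙 ω) = 0 := by
      rw [localizedModuleMap_smul_id]
      refine ModuleCat.hom_ext (LinearMap.ext fun y => ?_)
      change algebraMap R (Localization S) r • y = 0
      have h1 : IsLocalization.mk' (Localization S) r s • y = 0 := LinearMap.congr_fun ha y
      rw [← IsLocalization.mk'_spec' (Localization S) r s, mul_smul, h1, smul_zero]
    obtain ⟨t, ht, h⟩ := exists_smul_eq_zero_of_localizedModuleMap S _ h0
    have h2 : t * r = 0 := hω.bijective.1 (by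
      rw [map_zero]
      refine LinearMap.ext fun y => ?_
      exact (mul_smul t r y).trans congr($(h).hom y))
    exact (IsLocalization.mk'_eq_zero_iff r s).2 ⟨⟨t, ht⟩, h2⟩
  · intro g
    obtain ⟨f, s, hs, hf⟩ := exists_localizedModuleMap_eq S (ModuleCat.ofHom g)
    obtain ⟨r, hr⟩ := hω.bijective.2 f.hom
    have hfr : f = r • 𝟙 ω := ModuleCat.hom_ext hr.symm
    rw [hfr, localizedModuleMap_smul_id] at hf
    refine ⟨IsLocalization.mk' _ r ⟨s, hs⟩, LinearMap.ext fun y => ?_⟩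
    have hy : algebraMap R (Localization S) r • y = algebraMap R (Localization S) s • g y :=
      congr($(hf).hom y)
    change IsLocalization.mk' (Localization S) r ⟨s, hs⟩ • y = g y
    have hu := IsLocalization.map_units (Localization S) (⟨s, hs⟩ : S)
    refine hu.smul_left_cancel.1 ?_
    rw [← mul_smul, IsLocalization.mk'_spec']
    exact hy
  · rw [subsingleton_ext_localizedModule_iff]
    have := hω.subsingleton_ext i
    exact fun x => ⟨1, S.one_mem, Subsingleton.elim _ _⟩

end Localize

section Local

variable {A : Type u} [CommRing A]

lemma Canonical.annihilator_eq_bot {ω : ModuleCat.{u} A} (hω : Canonical ω) :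
    Module.annihilator A ω = ⊥ := by
  rw [eq_bot_iff]
  intro r hr
  rw [Module.mem_annihilator] at hr
  exact hω.bijective.1 (LinearMap.ext fun y => (hr y).trans (by rw [map_zero]; rfl))

lemma Canonical.nontrivial {ω : ModuleCat.{u} A} (hω : Canonical ω) [Nontrivial A] :
    Nontrivial ω := by
  by_contra h
  rw [not_nontrivial_iff_subsingleton] at h
  exact one_ne_zero (hω.bijective.1 (LinearMap.ext fun y => Subsingleton.elim _ _) :
    (1 : A) = 0)

lemma Canonical.exists_regQuot [IsLocalRing A] [IsNoetherianRing A] {ω : ModuleCat.{u} A}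
    (hω : Canonical ω) {d : ℕ} {Q : ModuleCat.{u} A} (hQ : RegQuot d (ModuleCat.of A A) Q) :
    ∃ Q', RegQuot d ω Q' := by
  have := hω.finite
  exact exists_regQuot_of_hom ω hω.annihilator_eq_bot hQ ω hω.finite hω.subsingleton_ext
    (LinearEquiv.ofBijective (Algebra.linearMap A (Module.End A ω)) hω.bijective)

lemma _root_.IsRegularSeq.isWeaklyRegular {rs : List A} (h : IsRegularSeq A rs) :
    RingTheory.Sequence.IsWeaklyRegular A rs := by
  rw [RingTheory.Sequence.isWeaklyRegular_iff]
  intro i hi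
  rw [isSMulRegular_iff_right_eq_zero_of_smul]
  intro y hy
  obtain ⟨y, rfl⟩ := Submodule.mkQ_surjective _ y
  have hspan : Ideal.ofList (rs.take i) • (⊤ : Submodule A A) =
      Ideal.span {x | x ∈ rs.take i} := by
    rw [smul_eq_mul, Ideal.mul_top]
  refine (Submodule.Quotient.mk_eq_zero _).2 ?_
  have h1 := (Submodule.Quotient.mk_eq_zero _).1 hy
  rw [hspan] at h1 ⊢
  exact h.1 i hi y h1

lemma _root_.IsCMLocalRing.exists_regQuot [IsLocalRing A] (h : IsCMLocalRing A) :
    ∃ (d : ℕ) (Q : ModuleCat.{u} A), RegQuot d (ModuleCat.of A A) Q ∧ ringKrullDim A = d := by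
  obtain ⟨-, -, rs, hrs, hu, hd⟩ := h
  obtain ⟨Q, hQ⟩ := exists_regQuot_of_isWeaklyRegular rs
    (fun r hr => (mem_maximalIdeal r).2 (hu r hr)) (ModuleCat.of A A) hrs.isWeaklyRegular
  exact ⟨rs.length, Q, hQ, hd.symm⟩

end Local
end LocalDuality

namespace LocalDuality
open Abelian IsLocalRing LocExt ChangeRings

section Semilinear

variable {R : Type u} [CommRing R] (S : Submonoid R) (φ : R →+* R) (q : ℕ)

/-- The localization of `R`, with `R` acting through `φ`. -/
noncomputable abbrev twistedLocalization : ModuleCat.{u} R :=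
  (ModuleCat.restrictScalars φ).obj ((ModuleCat.restrictScalars (algebraMap R (Localization S))).obj
    (ModuleCat.of (Localization S) (Localization S)))

/-- The localization map with both sides twisted by `φ`. -/
noncomputable def twistedLocalizationMap : (resSelf φ : ModuleCat.{u} R) →ₗ[R] twistedLocalization S φ where
  toFun r := (algebraMap R (Localization S) r : Localization S)
  map_add' := (algebraMap R (Localization S)).map_add
  map_smul' r x := (algebraMap R (Localization S)).map_mul (φ r) x

variable {φ q}

lemma isLocalizedModule_twistedLocalizationMap (hφ : ∀ r, φ r = r ^ q) (hq : q ≠ 0) :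
    IsLocalizedModule S (twistedLocalizationMap S φ) where
  map_units s := by
    rw [Module.End.isUnit_iff]
    have hu : IsUnit (algebraMap R (Localization S) (φ s)) := by
      rw [hφ, map_pow]
      exact (IsLocalization.map_units _ s).pow q
    have hb : Function.Bijective fun y : Localization S =>
        algebraMap R (Localization S) (φ s) * y := IsUnit.isUnit_iff_mulLeft_bijective.1 hu
    exact hb
  surj (y : Localization S) := by
    obtain ⟨r, s, hrs⟩ := IsLocalization.exists_mk'_eq S y
    refine ⟨⟨(s : R) ^ (q - 1) * r, s⟩, ?_⟩
    change algebraMap R (Localization S) (φ s) * y =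
      algebraMap R (Localization S) ((s : R) ^ (q - 1) * r)
    rw [hφ, ← pow_sub_one_mul hq (s : R), map_mul, map_mul, mul_assoc, ← hrs,
      IsLocalization.mk'_spec']
  exists_of_eq {x y} h := by
    change R at x y
    change algebraMap R (Localization S) x = algebraMap R (Localization S) y at h
    obtain ⟨c, hc⟩ := (IsLocalization.eq_iff_exists S (Localization S)).1 h
    refine ⟨c, ?_⟩
    change (φ c * x : R) = φ c * y
    rw [hφ, ← pow_sub_one_mul hq (c : R), mul_assoc, hc, mul_assoc]

lemma exists_semilinear_equiv (hφ : ∀ r, φ r = r ^ q) (hq : q ≠ 0) :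
    ∃ σ : (resSelf φ : ModuleCat.{u} R).localizedModule S ≃+ Localization S,
      ∀ (a : Localization S) m, σ (a • m) = a ^ q • σ m := by
  have := isLocalizedModule_twistedLocalizationMap S hφ hq
  let σ := IsLocalizedModule.linearEquiv S
    ((resSelf φ : ModuleCat.{u} R).localizedModuleMkLinearMap S) (twistedLocalizationMap S φ)
  let τ : (resSelf φ : ModuleCat.{u} R).localizedModule S ≃+ Localization S := σ.toAddEquiv
  have hτ (r : R) m : τ (algebraMap R (Localization S) r • m) =
      (algebraMap R (Localization S) r) ^ q * τ m := by
    rw [algebraMap_smul]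
    refine (map_smul σ r m).trans ?_
    change algebraMap R (Localization S) (φ r) * τ m = _
    rw [hφ, map_pow]
  refine ⟨τ, fun a m => ?_⟩
  obtain ⟨r, s, rfl⟩ := IsLocalization.exists_mk'_eq S a
  have hu := (IsLocalization.map_units (Localization S) s).pow q
  refine hu.mul_left_cancel ?_
  rw [← hτ, ← mul_smul, IsLocalization.mk'_spec', hτ, smul_eq_mul, ← mul_assoc, ← mul_pow,
    IsLocalization.mk'_spec']

end Semilinear

section Frobenius

variable {R : Type u} [CommRing R] [IsNoetherianRing R] {φ : R →+* R} {q : ℕ}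

lemma subsingleton_of_locally {N K : ModuleCat.{u} R} [Module.Finite R N] (i : ℕ)
    (h : ∀ (P : Ideal R) [P.IsPrime],
      Subsingleton (Ext (N.localizedModule P.primeCompl) (K.localizedModule P.primeCompl) i)) :
    Subsingleton (Ext N K i) := by
  refine subsingleton_of_forall_eq 0 fun x => ?_
  by_contra hx
  have hne : LinearMap.ker (LinearMap.toSpanSingleton R _ x) ≠ ⊤ := fun htop => hx (by
    have h1 : (1 : R) ∈ LinearMap.ker (LinearMap.toSpanSingleton R _ x) := htop ▸ trivial
    exact (one_smul R x).symm.trans h1)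
  obtain ⟨P, hP, hle⟩ := Ideal.exists_le_maximal _ hne
  obtain ⟨s, hs, h0⟩ := (subsingleton_ext_localizedModule_iff P.primeCompl N K i).1 (h P) x
  exact hs (hle h0)

lemma smul_resField_eq_zero {A : Type u} [CommRing A] [IsLocalRing A] :
    ∀ x ∈ maximalIdeal A, ∃ j : ℕ, ∀ n : resField A, x ^ j • n = 0 := by
  intro x hx
  refine ⟨1, fun n => ?_⟩
  obtain ⟨n, rfl⟩ := Ideal.Quotient.mk_surjective n
  rw [pow_one]
  exact Ideal.Quotient.eq_zero_iff_mem.2 (Ideal.mul_mem_right n _ hx)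

/-- The Frobenius pushforward of a Cohen-Macaulay local ring is Cohen-Macaulay. -/
lemma exists_regQuot_resSelf (hφ : ∀ r, φ r = r ^ q) (hq : q ≠ 0) (P : Ideal R) [P.IsPrime]
    {d : ℕ} {Q : ModuleCat.{u} (Localization P.primeCompl)}
    (hQ : RegQuot d (ModuleCat.of _ (Localization P.primeCompl)) Q) :
    ∃ Q', RegQuot d ((resSelf φ).localizedModule P.primeCompl) Q' := by
  obtain ⟨σ, hσ⟩ := exists_semilinear_equiv P.primeCompl hφ hq
  exact exists_regQuot_of_semilinear q d (resField _)
    (ModuleCat.of _ (Localization P.primeCompl)) _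
    (inferInstanceAs (Module.Finite (Localization P.primeCompl) (Localization P.primeCompl)))
    (hQ.subsingleton_ext_of_nilpotent _ smul_resField_eq_zero) σ hσ

theorem coAcyclic_of_canonical (hCM : IsCMRing R) {ω : ModuleCat.{u} R} (hω : Canonical ω)
    (hφ : ∀ r, φ r = r ^ q) (hq : q ≠ 0) (hfin : Module.Finite R (resSelf φ)) :
    CoAcyclic φ ω := by
  refine fun i => subsingleton_of_locally (i + 1) fun P hP => ?_
  obtain ⟨d, Q, hQ, hd⟩ := (hCM.2 P hP).exists_regQuot
  obtain ⟨Q', hQ'⟩ := exists_regQuot_resSelf hφ hq P hQ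
  have := (hω.localizedModule P.primeCompl).finite
  exact subsingleton_ext_of_regQuot hQ hd _ (hω.localizedModule P.primeCompl).finiteInjDim
    (finite_localizedModule P.primeCompl _) hQ' (i + 1) (by lia)

end Frobenius

end LocalDuality

namespace LocalDuality
open Abelian IsLocalRing LocExt ChangeRings

section Finite

variable {R S : Type u} [CommRing R] [CommRing S] {φ : R →+* S}

lemma finite_restrictScalars (hfin : Module.Finite R (resSelf φ)) (N : ModuleCat.{u} S)
    [Module.Finite S N] : Module.Finite R ((ModuleCat.restrictScalars φ).obj N) := by
  let := φ.toAlgebra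
  let : Module R N := Module.compHom N φ
  have : IsScalarTower R S N := ⟨fun r s n => mul_smul (φ r) s n⟩
  have hS : Module.Finite R S := hfin
  exact (Module.Finite.trans S N : Module.Finite R N)

/-- The module of homomorphisms from the restriction of scalars of `S`, over `R`. -/
noncomputable abbrev dualResSelf (φ : R →+* S) (ω : ModuleCat.{u} R) : ModuleCat.{u} R :=
  ModuleCat.of R (resSelf φ →ₗ[R] ω)

/-- The coextension of scalars, viewed as a module of homomorphisms. -/
noncomputable def coextendScalarsIso (φ : R →+* S) (ω : ModuleCat.{u} R) :
    dualResSelf φ ω ≅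
      (ModuleCat.restrictScalars φ).obj ((ModuleCat.coextendScalars.{u, u, u} φ).obj ω) :=
  letI W := (ModuleCat.restrictScalars φ).obj ((ModuleCat.coextendScalars.{u, u, u} φ).obj ω)
  letI e : (resSelf φ →ₗ[R] ω) ≃ₗ[R] W :=
    { (ModuleCat.CoextendScalars.equiv φ ω).symm.toAddEquiv with
      map_smul' r f := by
        apply (ModuleCat.CoextendScalars.equiv φ ω).injective
        change _ = ModuleCat.CoextendScalars.equiv φ ω
          (φ r • (ModuleCat.CoextendScalars.equiv φ ω).symm f)
        rw [map_smul, LinearEquiv.apply_symm_apply]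
        refine LinearMap.ext fun (s : S) => ?_
        change r • f s = f (s * φ r)
        rw [mul_comm]
        exact (f.map_smul r (show resSelf φ from s)).symm }
  e.toModuleIso

lemma finite_coextendScalars [IsNoetherianRing R] (hfin : Module.Finite R (resSelf φ))
    (ω : ModuleCat.{u} R) [Module.Finite R ω] :
    Module.Finite S ((ModuleCat.coextendScalars.{u, u, u} φ).obj ω) := by
  let := φ.toAlgebra
  let W := (ModuleCat.coextendScalars.{u, u, u} φ).obj ω
  let : Module R W := Module.compHom W φ
  have : IsScalarTower R S W := ⟨fun r s n => mul_smul (φ r) s n⟩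
  have h : Module.Finite R W := Module.Finite.equiv (coextendScalarsIso φ ω).toLinearEquiv
  exact Module.Finite.of_restrictScalars_finite R S W

lemma FiniteInjDim.coextendScalars {ω : ModuleCat.{u} R} (hco : CoAcyclic φ ω)
    (hω : FiniteInjDim ω) : FiniteInjDim ((ModuleCat.coextendScalars.{u, u, u} φ).obj ω) := by
  obtain ⟨n, hn⟩ := hω
  refine ⟨n, fun N i hi => ?_⟩
  have := hn ((ModuleCat.restrictScalars φ).obj N) i hi
  exact (coextExt_bijective hco N i).1.subsingleton

end Finite

section Residue

variable {R : Type u} [CommRing R]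

/-- The residue ring at `P`, localized at `P`. -/
noncomputable abbrev locResidue (P : Ideal R) [P.IsPrime] :
    ModuleCat.{u} (Localization P.primeCompl) :=
  (ModuleCat.of R (R ⧸ P)).localizedModule P.primeCompl

lemma exists_smul_eq_zero_of_localizedModuleMk (N : ModuleCat.{u} R) (S : Submonoid R) (n : N)
    (h : N.localizedModuleMkLinearMap S n = 0) : ∃ c : S, (c : R) • n = 0 :=
  (IsLocalizedModule.eq_zero_iff S (N.localizedModuleMkLinearMap S)).1 h

instance nontrivial_locResidue (P : Ideal R) [P.IsPrime] : Nontrivial (locResidue P) := by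
  refine ⟨⟨(ModuleCat.of R (R ⧸ P)).localizedModuleMkLinearMap P.primeCompl
    (1 : R ⧸ P), 0, fun h => ?_⟩⟩
  obtain ⟨c, hc⟩ := exists_smul_eq_zero_of_localizedModuleMk _ _ _ h
  refine c.2 (Ideal.Quotient.eq_zero_iff_mem.1 ?_)
  rw [← hc]
  exact (mul_one (Ideal.Quotient.mk P (c : R))).symm

lemma smul_localizedModule_eq_zero (N : ModuleCat.{u} R) (P : Ideal R) [P.IsPrime]
    (hN : ∀ r ∈ P, ∀ n : N, r • n = 0) (x : Localization P.primeCompl)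
    (hx : x ∈ maximalIdeal (Localization P.primeCompl)) (y : N.localizedModule P.primeCompl) :
    x • y = 0 := by
  obtain ⟨r, s, rfl⟩ := IsLocalization.exists_mk'_eq P.primeCompl x
  have hr : r ∈ P := (IsLocalization.AtPrime.mk'_mem_maximal_iff _ P r s).1 hx
  obtain ⟨⟨n, t⟩, ht⟩ := IsLocalizedModule.surj P.primeCompl
    (N.localizedModuleMkLinearMap P.primeCompl) y
  have hs := IsLocalization.map_units (Localization P.primeCompl) s
  have ht' := IsLocalization.map_units (Localization P.primeCompl) t
  rw [← hs.smul_left_cancel, ← ht'.smul_left_cancel, smul_zero, smul_zero, ← mul_smul,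
    ← mul_smul, mul_assoc, IsLocalization.mk'_spec', mul_comm, mul_smul, algebraMap_smul,
    algebraMap_smul]
  refine Eq.trans (congrArg (r • ·) ht) ?_
  change r • N.localizedModuleMkLinearMap P.primeCompl n = 0
  rw [← map_smul, hN r hr, map_zero]

end Residue

section Frobenius

variable {R : Type u} [CommRing R] [IsNoetherianRing R] {φ : R →+* R} {q : ℕ}

lemma subsingleton_ext_coextendScalars_iff (hφ : ∀ r, φ r = r ^ q) (hq : q ≠ 0)
    (hfin : Module.Finite R (resSelf φ)) {ω : ModuleCat.{u} R} (hco : CoAcyclic φ ω)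
    (N : ModuleCat.{u} R) [Module.Finite R N] (P : Ideal R) [P.IsPrime] (i : ℕ) :
    Subsingleton (Ext (N.localizedModule P.primeCompl)
      (((ModuleCat.coextendScalars.{u, u, u} φ).obj ω).localizedModule P.primeCompl) i) ↔
    Subsingleton (Ext (((ModuleCat.restrictScalars φ).obj N).localizedModule P.primeCompl)
      (ω.localizedModule P.primeCompl) i) := by
  have := finite_restrictScalars hfin N
  have hbij := coextExt_bijective hco N i
  rw [subsingleton_ext_localizedModule_iff, subsingleton_ext_localizedModule_iff]
  constructor
  · intro h x
    obtain ⟨y, rfl⟩ := hbij.2 x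
    obtain ⟨s, hs, hy⟩ := h y
    refine ⟨s, hs, ?_⟩
    rw [← coextExt_smul, hφ, ← pow_sub_one_mul hq s, mul_smul, hy, smul_zero, adjExt_zero]
  · intro h y
    obtain ⟨s, hs, hy⟩ := h (adjExt (ModuleCat.restrictCoextendScalarsAdj.{u, u, u} φ) y)
    refine ⟨φ s, ?_, hbij.1 ?_⟩
    · rw [hφ]
      exact pow_mem hs q
    · rw [coextExt_smul, hy, adjExt_zero]

variable (hCM : IsCMRing R) {ω : ModuleCat.{u} R} (hω : Canonical ω) (hφ : ∀ r, φ r = r ^ q)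
  (hq : q ≠ 0) (hfin : Module.Finite R (resSelf φ)) (P : Ideal R) [P.IsPrime]
include hCM hω hφ hq hfin

lemma exists_regQuot_coextendScalars {d : ℕ} {Q : ModuleCat.{u} (Localization P.primeCompl)}
    (hQ : RegQuot d (ModuleCat.of _ (Localization P.primeCompl)) Q) :
    ∃ Q', RegQuot d
      (((ModuleCat.coextendScalars.{u, u, u} φ).obj ω).localizedModule P.primeCompl) Q' := by
  have hco := coAcyclic_of_canonical hCM hω hφ hq hfin
  have := hω.finite
  have hWfin := finite_coextendScalars hfin ω
  have hk : Module.Finite (Localization P.primeCompl) (locResidue P) :=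
    @finite_localizedModule _ _ _ _ (inferInstanceAs (Module.Finite R (R ⧸ P)))
  refine exists_regQuot_of_subsingleton_ext d (locResidue P) _
    (finite_localizedModule P.primeCompl _) fun i hi => ?_
  have : Module.Finite R (ModuleCat.of R (R ⧸ P)) := inferInstanceAs (Module.Finite R (R ⧸ P))
  rw [subsingleton_ext_coextendScalars_iff hφ hq hfin hco]
  obtain ⟨Q', hQ'⟩ := (hω.localizedModule P.primeCompl).exists_regQuot hQ
  refine hQ'.subsingleton_ext_of_nilpotent _ (fun x hx => ⟨1, fun y => ?_⟩) i hi
  rw [pow_one]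
  refine smul_localizedModule_eq_zero _ P (fun r hr n => ?_) x hx y
  change R ⧸ P at n
  obtain ⟨n, rfl⟩ := Ideal.Quotient.mk_surjective n
  refine Ideal.Quotient.eq_zero_iff_mem.2 (Ideal.mul_mem_right n _ ?_)
  change φ r ∈ P
  rw [hφ]
  exact Ideal.pow_mem_of_mem P hr q (Nat.pos_of_ne_zero hq)

lemma nontrivial_coextendScalars :
    Nontrivial
      (((ModuleCat.coextendScalars.{u, u, u} φ).obj ω).localizedModule P.primeCompl) := by
  by_contra hn
  rw [not_nontrivial_iff_subsingleton] at hn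
  have hco := coAcyclic_of_canonical hCM hω hφ hq hfin
  have : Module.Finite R (ModuleCat.of R R) := inferInstanceAs (Module.Finite R R)
  have h0 := (subsingleton_ext_coextendScalars_iff hφ hq hfin hco (ModuleCat.of R R) P 0).1
    (subsingleton_of_forall_eq 0 fun x => by
      obtain ⟨f, rfl⟩ := (Ext.mk₀_bijective _ _).2 x
      rw [(ModuleCat.isZero_of_subsingleton _).eq_of_tgt f 0, Ext.mk₀_zero])
  have hωP := hω.localizedModule P.primeCompl
  have h1 : Subsingleton ((resSelf φ).localizedModule P.primeCompl →ₗ[Localization P.primeCompl]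
      ω.localizedModule P.primeCompl) :=
    ((Ext.linearEquiv₀ (R := Localization P.primeCompl)).toEquiv.trans
      (ModuleCat.homLinearEquiv (S := Localization P.primeCompl)).toEquiv).symm.subsingleton
  have := hωP.finite
  have := hωP.nontrivial
  have := finite_localizedModule P.primeCompl (resSelf φ)
  obtain ⟨r, hr, hreg⟩ := IsSMulRegular.subsingleton_linearMap_iff.1 h1
  obtain ⟨σ, hσ⟩ := exists_semilinear_equiv P.primeCompl hφ hq
  have hrq : r ^ q = 0 := by
    have := hσ r (σ.symm 1)
    rw [Module.mem_annihilator.1 hr, map_zero, σ.apply_symm_apply, smul_eq_mul, mul_one] at this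
    exact this.symm
  obtain ⟨y, hy⟩ := exists_ne (0 : ω.localizedModule P.primeCompl)
  refine hy (hreg.pow q ?_)
  change r ^ q • y = r ^ q • (0 : ω.localizedModule P.primeCompl)
  rw [hrq, zero_smul, zero_smul]

end Frobenius

end LocalDuality

namespace LocalDuality
open Abelian IsLocalRing LocExt ChangeRings

lemma smul_ext_resField_eq_zero {A : Type u} [CommRing A] [IsLocalRing A] {C : ModuleCat.{u} A}
    {i : ℕ} {x : A} (hx : x ∈ maximalIdeal A) (a : Ext (resField A) C i) : x • a = 0 := by
  have h0 : x • 𝟙 (resField A) = 0 := by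
    refine ModuleCat.hom_ext (LinearMap.ext fun y => ?_)
    obtain ⟨y, rfl⟩ := Ideal.Quotient.mk_surjective y
    exact Ideal.Quotient.eq_zero_iff_mem.2 (Ideal.mul_mem_right y _ hx)
  rw [← smul_comp_id, h0, Ext.mk₀_zero, Ext.zero_comp]

lemma exists_comp_eq_smul_id {R : Type u} [CommRing R] [IsNoetherianRing R] {φ : R →+* R} {q : ℕ}
    (hCM : IsCMRing R) {ω : ModuleCat.{u} R} (hω : Canonical ω) (hφ : ∀ r, φ r = r ^ q)
    (hq : q ≠ 0) (hfin : Module.Finite R (resSelf φ)) (P : Ideal R) [P.IsPrime] :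
    ∃ (f : ω ⟶ (ModuleCat.coextendScalars.{u, u, u} φ).obj ω)
      (g : (ModuleCat.coextendScalars.{u, u, u} φ).obj ω ⟶ ω) (u : R), u ∉ P ∧
      f ≫ g = u • 𝟙 ω := by
  obtain ⟨d, Q, hQ, hd⟩ := (hCM.2 P inferInstance).exists_regQuot
  have hco := coAcyclic_of_canonical hCM hω hφ hq hfin
  have := hω.finite
  have := finite_coextendScalars hfin ω
  obtain ⟨QW, hQW⟩ := exists_regQuot_coextendScalars hCM hω hφ hq hfin P hQ
  have := nontrivial_coextendScalars hCM hω hφ hq hfin P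
  have hWinj := (hω.finiteInjDim.coextendScalars hco).localizedModule P.primeCompl
  have hωP := hω.localizedModule P.primeCompl
  have := hωP.nontrivial
  have hωPfin := hωP.finite
  obtain ⟨Qω, hQω⟩ := hωP.exists_regQuot hQ
  obtain ⟨a, ha⟩ := exists_ext_resField_ne_zero hQ hd _ hωP.finiteInjDim
  have hWfin := finite_localizedModule P.primeCompl
    ((ModuleCat.coextendScalars.{u, u, u} φ).obj ω)
  obtain ⟨f₀, hf₀⟩ := exists_comp_ne_zero hQ hd _ hWinj hQω hωPfin a ha 0 (add_zero d)
  obtain ⟨g₀, hg₀⟩ := exists_comp_ne_zero hQ hd _ hωP.finiteInjDim hQW hWfin _ hf₀ 0 (add_zero d)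
  obtain ⟨f₁, rfl⟩ := (Ext.mk₀_bijective _ _).2 f₀
  obtain ⟨g₁, rfl⟩ := (Ext.mk₀_bijective _ _).2 g₀
  rw [Ext.comp_assoc_of_third_deg_zero, Ext.mk₀_comp_mk₀] at hg₀
  obtain ⟨f, s, hs, hf⟩ := exists_localizedModuleMap_eq P.primeCompl f₁
  obtain ⟨g, t, ht, hg⟩ := exists_localizedModuleMap_eq P.primeCompl g₁
  obtain ⟨u, hu⟩ := hω.bijective.2 (f ≫ g).hom
  have hfg : f ≫ g = u • 𝟙 ω := ModuleCat.hom_ext hu.symm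
  refine ⟨f, g, u, fun huP => hg₀ ?_, hfg⟩
  have hloc : algebraMap R (Localization P.primeCompl) u • 𝟙 (ω.localizedModule P.primeCompl) =
      algebraMap R (Localization P.primeCompl) (s * t) • (f₁ ≫ g₁) := by
    have h : ModuleCat.localizedModuleMap P.primeCompl (f ≫ g) =
        ModuleCat.localizedModuleMap P.primeCompl f ≫ ModuleCat.localizedModuleMap P.primeCompl g :=
      (ModuleCat.localizedModuleFunctor P.primeCompl).map_comp f g
    rw [hfg, localizedModuleMap_smul_id, hf, hg, Linear.smul_comp, Linear.comp_smul, smul_smul,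
      ← map_mul] at h
    exact h
  have hunit := IsLocalization.map_units (Localization P.primeCompl)
    (⟨s * t, mul_mem hs ht⟩ : P.primeCompl)
  rw [← hunit.smul_left_cancel, smul_zero]
  have h2 : algebraMap R (Localization P.primeCompl) (s * t) •
      a.comp (Ext.mk₀ (f₁ ≫ g₁)) (add_zero d) =
      algebraMap R (Localization P.primeCompl) u • a := by
    rw [← Ext.comp_smul, ← Ext.mk₀_smul, ← hloc, Ext.mk₀_smul, Ext.comp_smul, Ext.comp_mk₀_id]
  refine h2.trans (smul_ext_resField_eq_zero ?_ a)
  exact (IsLocalization.AtPrime.to_map_mem_maximal_iff _ P u).2 huP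

end LocalDuality

namespace ExtAnn
open Abelian ChangeRings

section

variable {R : Type u} [CommRing R]

/-- The quotient `M / J M`. -/
abbrev quotSMul (J : Ideal R) (M : ModuleCat.{u} R) : ModuleCat.{u} R :=
  ModuleCat.of R (M ⧸ (J • ⊤ : Submodule R M))

/-- The map induced on quotients by `J M ⊆ M` and `J N ⊆ N`. -/
noncomputable def quotSMulMap (J : Ideal R) {M N : ModuleCat.{u} R} (f : M ⟶ N) :
    quotSMul J M ⟶ quotSMul J N :=
  ModuleCat.ofHom (Submodule.mapQ _ _ f.hom (by
    rw [← Submodule.map_le_iff_le_comap, Submodule.map_smul'']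
    exact Submodule.smul_mono le_rfl le_top))

lemma quotSMulMap_comp_eq_smul_id (J : Ideal R) {M N : ModuleCat.{u} R} {f : M ⟶ N} {g : N ⟶ M}
    {u : R} (h : f ≫ g = u • 𝟙 M) : quotSMulMap J f ≫ quotSMulMap J g = u • 𝟙 _ := by
  refine ModuleCat.hom_ext (LinearMap.ext fun y => ?_)
  obtain ⟨y, rfl⟩ := Submodule.Quotient.mk_surjective _ y
  exact congrArg (Submodule.Quotient.mk (p := (J • ⊤ : Submodule R M))) congr($(h).hom y)

lemma sum_quotSMulMap_comp (J : Ideal R) {ι : Type} [Fintype ι] {M : ModuleCat.{u} R}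
    {N : ι → ModuleCat.{u} R} {f : ∀ a, M ⟶ N a} {g : ∀ a, N a ⟶ M}
    (h : ∑ a, f a ≫ g a = 𝟙 M) :
    ∑ a, quotSMulMap J (f a) ≫ quotSMulMap J (g a) = 𝟙 _ := by
  refine ModuleCat.hom_ext (LinearMap.ext fun y => ?_)
  obtain ⟨y, rfl⟩ := Submodule.Quotient.mk_surjective _ y
  have hy : ∑ a, (g a).hom ((f a).hom y) = y := by
    have := congr($(h).hom y)
    rw [ModuleCat.hom_sum, LinearMap.sum_apply] at this
    exact this
  rw [ModuleCat.hom_sum, LinearMap.sum_apply]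
  refine Eq.trans ?_ (congrArg (Submodule.Quotient.mk (p := (J • ⊤ : Submodule R M))) hy)
  exact (map_sum (Submodule.mkQ (J • ⊤ : Submodule R M)) _ _).symm

/-- The annihilator of the extension class `x` is `P`. -/
def HasAnn {X C : ModuleCat.{u} R} {n : ℕ} (P : Ideal R) (x : Ext X C n) : Prop :=
  ∀ r : R, r • x = 0 ↔ r ∈ P

lemma HasAnn.iso_comp {X Y C : ModuleCat.{u} R} {n : ℕ} {P : Ideal R} {x : Ext X C n}
    (hx : HasAnn P x) (e : Y ≅ X) : HasAnn P ((Ext.mk₀ e.hom).comp x (zero_add n)) := by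
  intro r
  rw [← hx r, ← Ext.comp_smul]
  constructor
  · intro h
    have h2 := congrArg (fun z => (Ext.mk₀ e.inv).comp z (zero_add n)) h
    simp only [Ext.mk₀_comp_mk₀_assoc, Iso.inv_hom_id, Ext.mk₀_id_comp] at h2
    rw [h2]
    exact Ext.comp_zero _ _ _ _ _
  · intro h
    rw [h]
    exact Ext.comp_zero _ _ _ _ _

lemma exists_hasAnn_quot {M W : ModuleCat.{u} R} {n : ℕ} {P : Ideal R} [hP : P.IsPrime]
    (J : Ideal R) {x : Ext (quotSMul J M) M n} (hx : HasAnn P x)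
    (f : M ⟶ W) (g : W ⟶ M) {u : R} (hu : u ∉ P) (hfg : f ≫ g = u • 𝟙 M) :
    ∃ z : Ext (quotSMul J W) W n, HasAnn P z := by
  refine ⟨(Ext.mk₀ (quotSMulMap J g)).comp (x.comp (Ext.mk₀ f) (add_zero n)) (zero_add n),
    fun r => ⟨fun h => ?_, fun h => ?_⟩⟩
  · have h2 := congrArg (fun z => ((Ext.mk₀ (quotSMulMap J f)).comp z (zero_add n)).comp
      (Ext.mk₀ g) (add_zero n)) h
    simp only [Ext.comp_smul, Ext.smul_comp, Ext.mk₀_comp_mk₀_assoc,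
      quotSMulMap_comp_eq_smul_id J hfg,
      Ext.comp_assoc_of_third_deg_zero, Ext.mk₀_comp_mk₀, hfg, Ext.mk₀_smul, Ext.comp_mk₀_id] at h2
    rw [Ext.zero_comp, Ext.comp_zero, Ext.mk₀_id_comp, ← mul_smul, ← mul_smul, hx] at h2
    exact (hP.mem_or_mem ((hP.mem_or_mem h2).resolve_right hu)).resolve_right hu
  · rw [← Ext.comp_smul, ← Ext.smul_comp, (hx r).2 h, Ext.zero_comp, Ext.comp_zero]

lemma exists_hasAnn_of_sum {ι : Type} [Fintype ι] {X C : ModuleCat.{u} R}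
    {Y : ι → ModuleCat.{u} R} {f : ∀ a, X ⟶ Y a} {g : ∀ a, Y a ⟶ X}
    (h : ∑ a, f a ≫ g a = 𝟙 X) {n : ℕ} {P : Ideal R} [hP : P.IsPrime] {x : Ext X C n}
    (hx : HasAnn P x) : ∃ (a : ι) (y : Ext (Y a) C n), HasAnn P y := by
  by_contra! hne
  have hex : ∀ a, ∃ r : R, r ∉ P ∧ r • (Ext.mk₀ (g a)).comp x (zero_add n) = 0 := by
    intro a
    by_contra! hr
    refine hne a ((Ext.mk₀ (g a)).comp x (zero_add n)) fun r => ⟨fun h0 => ?_, fun h0 => ?_⟩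
    · by_contra hrP
      exact hr r hrP h0
    · rw [← Ext.comp_smul, (hx r).2 h0, Ext.comp_zero]
  choose r hrP hr using hex
  have hprod : (∏ a, r a) ∈ P := by
    rw [← hx, ← LocalDuality.smul_comp_id, ← h, Finset.smul_sum, Ext.mk₀_sum, Ext.sum_comp]
    refine Finset.sum_eq_zero fun a _ => ?_
    obtain ⟨c, hc⟩ := Finset.dvd_prod_of_mem r (Finset.mem_univ a)
    rw [Ext.mk₀_smul, Ext.smul_comp, ← Ext.mk₀_comp_mk₀, Ext.comp_assoc_of_second_deg_zero,
      ← Ext.comp_smul, hc, mul_comm, mul_smul, hr, smul_zero, Ext.comp_zero]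
  obtain ⟨a, -, ha⟩ := hP.prod_mem_iff.1 hprod
  exact hrP a ha

end

section Coextend

variable {R S : Type u} [CommRing R] [CommRing S] (φ : R →+* S)

lemma hasAnn_adjExt {K : ModuleCat.{u} R} {N : ModuleCat.{u} S} (hK : CoAcyclic φ K) {n : ℕ}
    {P : Ideal S} {x : Ext N ((ModuleCat.coextendScalars.{u, u, u} φ).obj K) n}
    (hx : HasAnn P x) :
    HasAnn (P.comap φ) (adjExt (ModuleCat.restrictCoextendScalarsAdj.{u, u, u} φ) x) := by
  intro r
  rw [← coextExt_smul, Ideal.mem_comap, ← hx]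
  constructor
  · intro h
    exact (coextExt_bijective hK N n).1 (h.trans (adjExt_zero _).symm)
  · intro h
    rw [h, adjExt_zero]

/-- Restriction of scalars commutes with reduction modulo an ideal. -/
noncomputable def quotRestrictScalarsIso (I : Ideal R) (W : ModuleCat.{u} S) :
    quotSMul I ((ModuleCat.restrictScalars φ).obj W) ≅
      (ModuleCat.restrictScalars φ).obj (quotSMul (I.map φ) W) :=
  letI := φ.toAlgebra
  letI : Module R W := Module.compHom W φ
  haveI : IsScalarTower R S W := ⟨fun r s n => mul_smul (φ r) s n⟩
  letI e : (W ⧸ (I • ⊤ : Submodule R W)) ≃ₗ[R]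
      (W ⧸ (I.map φ • ⊤ : Submodule S W).restrictScalars R) :=
    Submodule.quotEquivOfEq _ _ (Ideal.smul_restrictScalars (S := S) I ⊤).symm
  { hom := ModuleCat.ofHom (Y := (ModuleCat.restrictScalars φ).obj
        (ModuleCat.of S (W ⧸ (I.map φ • ⊤ : Submodule S W))))
      { toFun := e
        map_add' := map_add e
        map_smul' := map_smul e }
    inv := ModuleCat.ofHom (X := (ModuleCat.restrictScalars φ).obj
        (ModuleCat.of S (W ⧸ (I.map φ • ⊤ : Submodule S W))))
      { toFun := e.symm
        map_add' := map_add e.symm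
        map_smul' := map_smul e.symm }
    hom_inv_id := ModuleCat.hom_ext (LinearMap.ext e.symm_apply_apply)
    inv_hom_id := ModuleCat.hom_ext (LinearMap.ext e.apply_symm_apply) }

end Coextend

end ExtAnn

namespace ExtAnn
open Abelian ChangeRings

section Decomposition

variable {R : Type u} [CommRing R] {t : ℕ} {M : Fin t → Type u} [∀ i, AddCommGroup (M i)]
  [∀ i, Module R (M i)] {m : Fin t → ℕ} {X : Type u} [AddCommGroup X] [Module R X]

lemma exists_sum_comp_eq_id (ψ : X ≃ₗ[R] ⨁ i : Fin t, (Fin (m i) → M i)) :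
    ∃ (π : ∀ a : Σ i, Fin (m i), X →ₗ[R] M a.1) (ι : ∀ a : Σ i, Fin (m i), M a.1 →ₗ[R] X),
      ∀ x, ∑ a, ι a (π a x) = x := by
  classical
  refine ⟨fun a => LinearMap.proj a.2 ∘ₗ DirectSum.component R _ _ a.1 ∘ₗ ψ.toLinearMap,
    fun a => ψ.symm.toLinearMap ∘ₗ DirectSum.lof R _ (fun i => Fin (m i) → M i) a.1 ∘ₗ
      LinearMap.single R (fun _ => M a.1) a.2, fun x => ?_⟩
  obtain ⟨y, rfl⟩ := ψ.symm.surjective x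
  rw [Fintype.sum_sigma]
  simp only [LinearMap.comp_apply, LinearEquiv.coe_coe, LinearEquiv.apply_symm_apply,
    LinearMap.proj_apply, ← map_sum]
  congr 1
  have hj : ∀ j, ∑ b, DirectSum.lof R (Fin t) (fun i => Fin (m i) → M i) j
      (LinearMap.single R (fun _ => M j) b (DirectSum.component R _ _ j y b)) =
      DirectSum.lof R _ _ j (DirectSum.component R _ (fun i => Fin (m i) → M i) j y) := fun j => by
    rw [← map_sum]
    congr 1
    exact Finset.univ_sum_single _
  refine (Finset.sum_congr rfl fun j _ => hj j).trans ?_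
  refine DirectSum.ext_component R fun i => ?_
  rw [map_sum, Finset.sum_eq_single i]
  · exact DirectSum.component.lof_self ..
  · intro j _ hj
    exact DirectSum.component.of .. |>.trans (dif_neg hj)
  · simp

lemma exists_sum_dual_comp_eq_id (ψ : X ≃ₗ[R] ⨁ i : Fin t, (Fin (m i) → M i))
    (ω : Type u) [AddCommGroup ω] [Module R ω] :
    ∃ (f : ∀ a : Σ i, Fin (m i), ModuleCat.of R (X →ₗ[R] ω) ⟶ ModuleCat.of R (M a.1 →ₗ[R] ω))
      (g : ∀ a : Σ i, Fin (m i), ModuleCat.of R (M a.1 →ₗ[R] ω) ⟶ ModuleCat.of R (X →ₗ[R] ω)),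
      ∑ a, f a ≫ g a = 𝟙 _ := by
  obtain ⟨π, ι, h⟩ := exists_sum_comp_eq_id ψ
  refine ⟨fun a => ModuleCat.ofHom (LinearMap.lcomp R ω (ι a)),
    fun a => ModuleCat.ofHom (LinearMap.lcomp R ω (π a)),
    ModuleCat.hom_ext (LinearMap.ext fun v => LinearMap.ext fun x => ?_)⟩
  rw [ModuleCat.hom_sum, LinearMap.sum_apply, LinearMap.sum_apply]
  refine Eq.trans ?_ (congrArg (v : X → ω) (h x))
  exact (map_sum v _ _).symm

variable {φ : R →+* R} {q : ℕ}

/-- A Frobenius-semilinear decomposition as a linear equivalence. -/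
noncomputable def resSelfEquiv {Y : Type u} [AddCommGroup Y] [Module R Y]
    (hφ : ∀ r, φ r = r ^ q) (ψ : R ≃+ Y) (hψ : ∀ r y : R, ψ (r ^ q * y) = r • ψ y) :
    resSelf φ ≃ₗ[R] Y where
  toFun := ψ
  invFun := ψ.symm
  left_inv := ψ.left_inv
  right_inv := ψ.right_inv
  map_add' := ψ.map_add
  map_smul' r y := (congrArg ψ (congrArg (fun x : R => x * (show R from y)) (hφ r))).trans (hψ r y)

end Decomposition

end ExtAnn

namespace ExtAnn
open Abelian ChangeRings LocCoh

variable {R : Type u} [CommRing R]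

lemma stableAnn_comp_iso {I P : Ideal R} {k n : ℕ} {Y Z : ModuleCat.{u} R}
    {y : Ext (ModuleCat.of R (R ⧸ I ^ k)) Y n} (hy : StableAnn I P y) (e : Y ≅ Z) :
    StableAnn I P (y.comp (Ext.mk₀ e.hom) (add_zero n)) := by
  intro k' hk r
  rw [← hy k' hk r, restr, restr, ← Ext.comp_assoc_of_third_deg_zero, ← Ext.smul_comp]
  constructor
  · intro h
    have h2 := congrArg (fun z => z.comp (Ext.mk₀ e.inv) (add_zero n)) h
    simp only [Ext.comp_assoc_of_third_deg_zero, Ext.mk₀_comp_mk₀, Iso.hom_inv_id,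
      Ext.comp_mk₀_id] at h2
    rw [h2]
    exact Ext.zero_comp _ _ _ _ _
  · intro h
    rw [h]
    exact Ext.zero_comp _ _ _ _ _

lemma mem_associatedPrimes_extCat [IsNoetherianRing R] {X C : ModuleCat.{u} R} {n : ℕ}
    {P : Ideal R} [hP : P.IsPrime] {x : Ext X C n} (hx : HasAnn P x) :
    P ∈ associatedPrimes R (extCat R n X C) := by
  rw [AssociatedPrimes.mem_iff, isAssociatedPrime_iff]
  refine ⟨hP, (ExtBridge.extEquiv n X C).symm x, Ideal.ext fun r => ?_⟩
  rw [Submodule.mem_colon_singleton, Submodule.mem_bot, ← map_smul,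
    LinearEquiv.map_eq_zero_iff, hx]

variable {φ : R →+* R} {q : ℕ}

lemma map_le_pow (hφ : ∀ r, φ r = r ^ q) (I : Ideal R) : I.map φ ≤ I ^ q := by
  refine Ideal.map_le_iff_le_comap.2 fun r hr => ?_
  rw [Ideal.mem_comap, hφ]
  exact Ideal.pow_mem_pow hr q

lemma exists_pow_le_map [IsNoetherianRing R] (hφ : ∀ r, φ r = r ^ q) (I : Ideal R) :
    ∃ m, I ^ m ≤ I.map φ := by
  refine Ideal.exists_pow_le_of_le_radical_of_fg (fun r hr => ⟨q, ?_⟩) (IsNoetherian.noetherian I)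
  rw [← hφ]
  exact Ideal.mem_map_of_mem φ hr

lemma comap_eq_of_isPrime (hφ : ∀ r, φ r = r ^ q) (hq : q ≠ 0) (P : Ideal R) [hP : P.IsPrime] :
    P.comap φ = P := by
  ext r
  rw [Ideal.mem_comap, hφ, hP.pow_mem_iff_mem q (Nat.pos_of_ne_zero hq)]

lemma exists_hasAnn_restrictScalars [IsNoetherianRing R] (hCM : IsCMRing R)
    {ω : ModuleCat.{u} R} (hω : LocalDuality.Canonical ω) (hφ : ∀ r, φ r = r ^ q) (hq : q ≠ 0)
    (hfin : Module.Finite R (resSelf φ)) (I : Ideal R) {n : ℕ} {P : Ideal R} [P.IsPrime]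
    {z : Ext (quotSMul (I.map φ) ω) ω n} (hz : HasAnn P z) :
    ∃ x : Ext (quotSMul I (LocalDuality.dualResSelf φ ω)) ω n, HasAnn P x := by
  obtain ⟨f, g, u, hu, hfg⟩ := LocalDuality.exists_comp_eq_smul_id hCM hω hφ hq hfin P
  obtain ⟨w, hw⟩ := exists_hasAnn_quot _ hz f g hu hfg
  have hx := hasAnn_adjExt φ (LocalDuality.coAcyclic_of_canonical hCM hω hφ hq hfin) hw
  rw [comap_eq_of_isPrime hφ hq] at hx
  let e := LocalDuality.coextendScalarsIso φ ω
  have he (X Y : ModuleCat.{u} R) (e : X ≅ Y) : quotSMulMap I e.hom ≫ quotSMulMap I e.inv = 𝟙 _ :=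
    (quotSMulMap_comp_eq_smul_id I (u := 1) (by rw [e.hom_inv_id, one_smul])).trans (one_smul _ _)
  let e' : quotSMul I (LocalDuality.dualResSelf φ ω) ≅
      quotSMul I ((ModuleCat.restrictScalars φ).obj
        ((ModuleCat.coextendScalars.{u, u, u} φ).obj ω)) :=
    ⟨quotSMulMap I e.hom, quotSMulMap I e.inv, he _ _ e, he _ _ e.symm⟩
  have h := hx.iso_comp (e' ≪≫ quotRestrictScalarsIso φ I _)
  exact ⟨_, h⟩

end ExtAnn

/-- Let `R` be a Cohen-Macaulay ring of prime characteristic `p` with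
finite F-representation type by finitely generated `R`-modules `M_1, …, M_t`, admitting a
canonical module `ω_R`.  Suppose `R_𝔭` is Gorenstein for every nonmaximal prime ideal
`𝔭`.  Let `I` be an ideal and `n` an integer.  Then
`Ass_R H_I^n(R) ⊆ ⋃_i Ass_R Ext_R^n(M_i†/IM_i†, ω_R)`, where `(−)† = Hom_R(−, ω_R)`. -/
theorem stmt5 {R : Type u} [CommRing R] (hCM : IsCMRing R)
    (p : ℕ) (hp : p.Prime) [CharP R p]
    -- finite F-representation type by finitely generated modules `M_1, …, M_t`:
    (t : ℕ) (M : Fin t → Type u) [∀ i, AddCommGroup (M i)] [∀ i, Module R (M i)]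
    (hfg : ∀ i, Module.Finite R (M i))
    (hFFRT : ∀ e : ℕ, ∃ (m : Fin t → ℕ)
      (ψ : R ≃+ ⨁ i : Fin t, (Fin (m i) → M i)),
        ∀ r y : R, ψ (r ^ p ^ e * y) = r • ψ y)
    -- a canonical module `ω_R`:
    (ω : Type u) [AddCommGroup ω] [Module R ω] (hω : IsCanonicalModule R ω)
    -- `R_𝔭` is Gorenstein for every nonmaximal prime ideal `𝔭`:
    (hGor : ∀ (P : Ideal R) (h : P.IsPrime), ¬P.IsMaximal →
      IsGorensteinLocalRing (Localization (@Ideal.primeCompl R _ P h)))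
    (I : Ideal R) (n : ℕ) :
    associatedPrimes R ((localCohomology I n).obj (ModuleCat.of R R)) ⊆
      ⋃ i : Fin t, associatedPrimes R
        (extCat R n
          (ModuleCat.of R ((M i →ₗ[R] ω) ⧸ (I • (⊤ : Submodule R (M i →ₗ[R] ω)))))
          (ModuleCat.of R ω)) := by
  have := hCM.1
  have hc := IsCanonicalModule.canonical hω
  have := hc.finite
  have : Fact p.Prime := ⟨hp⟩
  intro P hP
  obtain ⟨hprime, k, y, hy⟩ := LocCoh.exists_stable_annihilator I n _ P hP
  let e₀ : ModuleCat.of R R ≅ ModuleCat.of R (ModuleCat.of R ω →ₗ[R] ModuleCat.of R ω) :=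
    (LinearEquiv.ofBijective (Algebra.linearMap R (Module.End R ω)) hc.bijective).toModuleIso
  obtain ⟨k₁, hk₁⟩ := LocCoh.exists_ext_quot_of_stableAnn (ModuleCat.of R ω) I P n
    (ModuleCat.of R ω) hc.subsingleton_ext k _ (ExtAnn.stableAnn_comp_iso hy e₀)
  obtain ⟨e, he⟩ : ∃ e, k₁ ≤ p ^ e := ⟨k₁, (Nat.lt_pow_self hp.one_lt).le⟩
  have hφ : ∀ r, iterateFrobenius R p e r = r ^ p ^ e := iterateFrobenius_def p e
  have hq : p ^ e ≠ 0 := pow_ne_zero e hp.ne_zero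
  obtain ⟨z, hz⟩ := hk₁ (I.map (iterateFrobenius R p e))
    ((ExtAnn.map_le_pow hφ I).trans (Ideal.pow_le_pow_right he)) (ExtAnn.exists_pow_le_map hφ I)
  obtain ⟨m, ψ, hψ⟩ := hFFRT e
  let ψ' := ExtAnn.resSelfEquiv hφ ψ hψ
  have hfin : Module.Finite R (ChangeRings.resSelf (iterateFrobenius R p e)) :=
    Module.Finite.equiv ((DirectSum.linearEquivFunOnFintype R _ _).symm.trans ψ'.symm)
  obtain ⟨x, hx⟩ := ExtAnn.exists_hasAnn_restrictScalars hCM hc hφ hq hfin I hz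
  obtain ⟨f, g, hfg⟩ := ExtAnn.exists_sum_dual_comp_eq_id ψ' ω
  obtain ⟨a, w, hw⟩ := ExtAnn.exists_hasAnn_of_sum (ExtAnn.sum_quotSMulMap_comp I hfg) hx
  exact Set.mem_iUnion.2 ⟨a.1, ExtAnn.mem_associatedPrimes_extCat hw⟩
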